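/- arXiv:math/0511257 — 4 statements merged into one kernel-verified Lean document; each statement's English description precedes it below -/
import Mathlib

section
/- Let a > 0 and let σ : ℝ → ℝ be bounded and continuous with σ not identically zero and a·‖σ‖_∞ < √2. Let s₀ ∈ ℝ satisfy σ(s₀) ≠ 0 and set ρ(s,t) := √(1 + (s − s₀)²). Then there exists a constant c > 0 (depending on s₀, a and σ) such that for every ψ ∈ C_c^∞(ℝ × (−a,a)) one has Q₀[ψ] − E₁·∥ψ∥²_{H₀} ≥ c·∫_{ℝ×(−a,a)} ρ(s,t)^{-2} |ψ(s,t)|² h₀(s,t) ds dt. -/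
open MeasureTheory Real Set

theorem Continuous.integrable_mul_norm_sq {X : Type*} [TopologicalSpace X] [MeasurableSpace X]
    [OpensMeasurableSpace X] {μ : Measure X} [IsFiniteMeasureOnCompacts μ] {k : X → ℝ} {g : X → ℂ}
    (hk : Continuous k) (hg : Continuous g) (hgc : HasCompactSupport g) :
    Integrable (fun x => k x * ‖g x‖ ^ 2) μ := by
  refine Continuous.integrable_of_hasCompactSupport (by fun_prop) (hgc.mono fun x hx h0 => hx ?_)
  simp [h0]

/-- If `w` solves the Riccati equation `w' + w² / p = q` on an open set containing the support of `f`,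
then the quadratic form with coefficients `p` and `q` is nonnegative at `f`. -/
theorem integral_nonneg_of_riccati {f : ℝ → ℂ} (hf : ContDiff ℝ 1 f) (hfc : HasCompactSupport f)
    {Ω : Set ℝ} (hΩ : IsOpen Ω) (hfΩ : tsupport f ⊆ Ω) {p q w w' : ℝ → ℝ}
    (hp : Continuous p) (hq : Continuous q) (hp0 : ∀ x ∈ Ω, 0 < p x)
    (hw : ∀ x ∈ Ω, HasDerivAt w (w' x) x) (hwq : ∀ x ∈ Ω, q x = w' x + w x ^ 2 / p x) :
    0 ≤ ∫ x, (p x * ‖deriv f x‖ ^ 2 + q x * ‖f x‖ ^ 2) := by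
  set G : ℝ → ℝ := fun x => w' x * ‖f x‖ ^ 2 + w x * (2 * inner ℝ (f x) (deriv f x)) with hG
  have hdc : Continuous (deriv f) := hf.continuous_deriv le_rfl
  have hfd : Differentiable ℝ f := hf.differentiable (by simp)
  have hGts : tsupport G ⊆ tsupport f := by
    refine closure_minimal (fun x hx => ?_) (isClosed_tsupport f)
    by_contra h
    exact hx (by simp [hG, image_eq_zero_of_notMem_tsupport h])
  have hwc : ContinuousOn w Ω := fun x hx => (hw x hx).continuousAt.continuousWithinAt
  have hw'c : ContinuousOn w' Ω := by
    have h1 : ContinuousOn (fun x => q x - w x ^ 2 / p x) Ω :=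
      hq.continuousOn.sub ((hwc.pow 2).div hp.continuousOn fun x hx => (hp0 x hx).ne')
    exact h1.congr fun x hx => by simp [hwq x hx]
  have hGc : Continuous G := by
    refine ContinuousOn.continuous_of_tsupport_subset ?_ hΩ (hGts.trans hfΩ)
    refine (hw'c.mul (hf.continuous.norm.pow 2).continuousOn).add (hwc.mul ?_)
    exact (continuous_const.mul (hf.continuous.inner hdc)).continuousOn
  have hGi : Integrable G :=
    hGc.integrable_of_hasCompactSupport (hfc.mono' ((subset_tsupport G).trans hGts))
  have hFi : Integrable (fun x => w x * ‖f x‖ ^ 2) := by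
    have hts : tsupport (fun x => w x * ‖f x‖ ^ 2) ⊆ tsupport f := by
      refine closure_minimal (fun x hx => ?_) (isClosed_tsupport f)
      by_contra h
      exact hx (by simp [image_eq_zero_of_notMem_tsupport h])
    refine Continuous.integrable_of_hasCompactSupport ?_ (hfc.mono' ((subset_tsupport _).trans hts))
    exact ContinuousOn.continuous_of_tsupport_subset
      (hwc.mul (hf.continuous.norm.pow 2).continuousOn) hΩ (hts.trans hfΩ)
  have hFd : ∀ x, HasDerivAt (fun x => w x * ‖f x‖ ^ 2) (G x) x := by
    intro x
    by_cases hx : x ∈ tsupport f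
    · exact (hw x (hfΩ hx)).mul (hfd x).hasDerivAt.norm_sq
    · have h0 : G x = 0 := by simp [hG, image_eq_zero_of_notMem_tsupport hx]
      rw [h0]
      refine (hasDerivAt_const x (0 : ℝ)).congr_of_eventuallyEq ?_
      filter_upwards [(isClosed_tsupport f).isOpen_compl.mem_nhds hx] with y hy
      simp [image_eq_zero_of_notMem_tsupport hy]
  have hG0 : ∫ x, G x = 0 := integral_eq_zero_of_hasDerivAt_of_integrable hFd hGi hFi
  rw [← hG0]
  refine integral_mono hGi ?_ fun x => ?_
  · refine Integrable.add ?_ ?_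
    · exact hp.integrable_mul_norm_sq hdc hfc.deriv
    · exact hq.integrable_mul_norm_sq hf.continuous hfc
  · by_cases hx : x ∈ tsupport f
    · have hpx := hp0 x (hfΩ hx)
      have hns : ‖deriv f x - (w x / p x) • f x‖ ^ 2 = ‖deriv f x‖ ^ 2
          - 2 * (w x / p x) * inner ℝ (f x) (deriv f x) + (w x / p x) ^ 2 * ‖f x‖ ^ 2 := by
        rw [norm_sub_sq_real, inner_smul_right, norm_smul, mul_pow, Real.norm_eq_abs, sq_abs,
          real_inner_comm]
        ring
      have hkey : p x * ‖deriv f x‖ ^ 2 + q x * ‖f x‖ ^ 2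
          = G x + p x * ‖deriv f x - (w x / p x) • f x‖ ^ 2 := by
        rw [hns, hwq x (hfΩ hx)]
        simp only [hG]
        field_simp
        ring
      change G x ≤ p x * ‖deriv f x‖ ^ 2 + q x * ‖f x‖ ^ 2
      rw [hkey]
      have : 0 ≤ p x * ‖deriv f x - (w x / p x) • f x‖ ^ 2 := by positivity
      linarith
    · have h1 : f x = 0 := image_eq_zero_of_notMem_tsupport hx
      have h2 : deriv f x = 0 := by
        by_contra h
        exact hx (support_deriv_subset h)
      simp [hG, h1, h2]

/-- Classical Hardy weight with a local defect of size `b`. -/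
theorem integral_hardy_nonneg {f : ℝ → ℂ} (hf : ContDiff ℝ 1 f) (hfc : HasCompactSupport f)
    {b : ℝ} (hb : 0 < b) (s₀ : ℝ) :
    0 ≤ ∫ x, (‖deriv f x‖ ^ 2 +
      (b ^ 2 / 2 - (x - s₀) ^ 2 / 4) / (b ^ 2 + (x - s₀) ^ 2) ^ 2 * ‖f x‖ ^ 2) := by
  have hpos : ∀ x : ℝ, 0 < b ^ 2 + (x - s₀) ^ 2 := fun x => by positivity
  have := integral_nonneg_of_riccati hf hfc isOpen_univ (subset_univ _) (p := fun _ => 1)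
    (q := fun x => (b ^ 2 / 2 - (x - s₀) ^ 2 / 4) / (b ^ 2 + (x - s₀) ^ 2) ^ 2)
    (w := fun x => (x - s₀) / (2 * (b ^ 2 + (x - s₀) ^ 2)))
    (w' := fun x => (b ^ 2 - (x - s₀) ^ 2) / (2 * (b ^ 2 + (x - s₀) ^ 2) ^ 2))
    continuous_const
    (Continuous.div (by fun_prop) (by fun_prop) fun x => (pow_pos (hpos x) 2).ne')
    (fun _ _ => one_pos) (fun x _ => ?_) (fun x _ => ?_)
  · simpa using this
  · have h1 : HasDerivAt (fun x : ℝ => x - s₀) 1 x := (hasDerivAt_id x).sub_const s₀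
    have h2 := ((h1.pow 2).const_add (b ^ 2)).const_mul 2
    refine (h1.div h2 (mul_ne_zero two_ne_zero (hpos x).ne')).congr_deriv ?_
    have := (hpos x).ne'
    simp only [Pi.pow_apply]
    field_simp
    push_cast
    ring
  · have := (hpos x).ne'
    field_simp
    ring

/-- Transverse lower bound on the interval `(-a, a)` with weight `√(1 + t² S²)`. -/
theorem integral_transverse_nonneg {f : ℝ → ℂ} (hf : ContDiff ℝ 1 f) (hfc : HasCompactSupport f)
    {a : ℝ} (ha : 0 < a) (hfa : tsupport f ⊆ Ioo (-a) a) (S : ℝ) :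
    0 ≤ ∫ t, (√(1 + t ^ 2 * S ^ 2) * ‖deriv f t‖ ^ 2 +
      (-(π ^ 2 / (2 * a) ^ 2) * √(1 + t ^ 2 * S ^ 2)
        - S ^ 2 * (2 - t ^ 2 * S ^ 2) / (4 * √(1 + t ^ 2 * S ^ 2) ^ 3)) * ‖f t‖ ^ 2) := by
  have hpos : ∀ t : ℝ, 0 < 1 + t ^ 2 * S ^ 2 := fun t => by positivity
  have hh : ∀ t : ℝ, 0 < √(1 + t ^ 2 * S ^ 2) := fun t => Real.sqrt_pos.2 (hpos t)
  have hsq : ∀ t : ℝ, √(1 + t ^ 2 * S ^ 2) ^ 2 = 1 + t ^ 2 * S ^ 2 :=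
    fun t => Real.sq_sqrt (hpos t).le
  have hcos : ∀ t ∈ Ioo (-a) a, 0 < cos (π / (2 * a) * t) := by
    intro t ht
    have hk : 0 < π / (2 * a) := by positivity
    have hka : π / (2 * a) * a = π / 2 := by field_simp
    refine Real.cos_pos_of_mem_Ioo ⟨?_, ?_⟩
    · nlinarith [ht.1]
    · nlinarith [ht.2]
  refine integral_nonneg_of_riccati hf hfc isOpen_Ioo hfa
    (w := fun t => -(t * S ^ 2 / (2 * √(1 + t ^ 2 * S ^ 2)))
      - π / (2 * a) * (√(1 + t ^ 2 * S ^ 2) * tan (π / (2 * a) * t)))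
    (w' := fun t => -(S ^ 2 / (2 * √(1 + t ^ 2 * S ^ 2) ^ 3))
      - π / (2 * a) * (t * S ^ 2 / √(1 + t ^ 2 * S ^ 2) * tan (π / (2 * a) * t)
        + √(1 + t ^ 2 * S ^ 2) * (π / (2 * a) * (1 + tan (π / (2 * a) * t) ^ 2))))
    (by fun_prop) ?_ (fun t _ => hh t) (fun t ht => ?_) (fun t ht => ?_)
  · refine Continuous.sub (by fun_prop) (Continuous.div (by fun_prop) (by fun_prop) fun t => ?_)
    exact mul_ne_zero four_ne_zero (pow_pos (hh t) 3).ne'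
  · have h1 : HasDerivAt (fun t : ℝ => √(1 + t ^ 2 * S ^ 2)) (t * S ^ 2 / √(1 + t ^ 2 * S ^ 2)) t := by
      have := ((((hasDerivAt_id t).pow 2).mul_const (S ^ 2)).const_add 1).sqrt (hpos t).ne'
      refine this.congr_deriv ?_
      simp only [id, Pi.pow_apply]
      field_simp
      push_cast
      ring
    have h2 : HasDerivAt (fun t : ℝ => t * S ^ 2) (S ^ 2) t := by
      simpa using (hasDerivAt_id t).mul_const (S ^ 2)
    have h3 : HasDerivAt (fun t : ℝ => tan (π / (2 * a) * t))
        (π / (2 * a) * (1 + tan (π / (2 * a) * t) ^ 2)) t := by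
      have h4 : HasDerivAt (fun t : ℝ => π / (2 * a) * t) (π / (2 * a)) t := by
        simpa using (hasDerivAt_id t).const_mul (π / (2 * a))
      refine ((Real.hasDerivAt_tan (hcos t ht).ne').comp t h4).congr_deriv ?_
      have hc := (hcos t ht).ne'
      rw [← Real.inv_one_add_tan_sq hc]
      simp [mul_comm]
    refine (((h2.div (h1.const_mul 2) (mul_ne_zero two_ne_zero (hh t).ne')).neg).sub
      ((h1.mul h3).const_mul (π / (2 * a)))).congr_deriv ?_
    have hne := (hh t).ne'
    congr 1
    congr 1
    have e := hsq t
    generalize √(1 + t ^ 2 * S ^ 2) = h at *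
    field_simp
    rw [e]
    ring
  · have hne := (hh t).ne'
    have e := hsq t
    generalize √(1 + t ^ 2 * S ^ 2) = h at *
    generalize tan (π / (2 * a) * t) = T at *
    have hk : π ^ 2 / (2 * a) ^ 2 = (π / (2 * a)) ^ 2 := by rw [div_pow]
    rw [hk]
    generalize π / (2 * a) = k at *
    field_simp
    ring

/-- Pointwise comparison behind the Hardy inequality: the defect of the classical Hardy weight on the
scale `b` is absorbed by a potential that is at least `m` on `|x| < 2 b`. -/
theorem exists_hardy_weight_le {b m : ℝ} (hb : 0 < b) (hm : 0 < m) :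
    ∃ ε > (0 : ℝ), ε ≤ 1 / 2 ∧ ∃ c > (0 : ℝ), ∀ x v : ℝ, 0 ≤ v → (|x| < 2 * b → m ≤ v) →
      c * (1 + x ^ 2)⁻¹ ≤ -(ε * ((b ^ 2 / 2 - x ^ 2 / 4) / (b ^ 2 + x ^ 2) ^ 2)) + v := by
  refine ⟨min (1 / 2) (m * b ^ 2), by positivity, min_le_left _ _, ?_⟩
  have hε : 0 < min (1 / 2) (m * b ^ 2) := by positivity
  have hεm : min (1 / 2) (m * b ^ 2) ≤ m * b ^ 2 := min_le_right _ _
  generalize min (1 / 2) (m * b ^ 2) = ε at hε hεm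
  refine ⟨min (ε * (2 / 25)) (m / 2), by positivity, fun x v hv hxv => ?_⟩
  have h1 : 0 < 1 + x ^ 2 := by positivity
  have h2 : 0 < b ^ 2 + x ^ 2 := by positivity
  by_cases hx : |x| < 2 * b
  · have hA : min (ε * (2 / 25)) (m / 2) * (1 + x ^ 2)⁻¹ ≤ m / 2 := by
      have : (1 + x ^ 2)⁻¹ ≤ 1 := inv_le_one_of_one_le₀ (by nlinarith)
      calc _ ≤ m / 2 * 1 := mul_le_mul (min_le_right _ _) this (by positivity) (by positivity)
        _ = m / 2 := mul_one _
    have hB : (b ^ 2 / 2 - x ^ 2 / 4) / (b ^ 2 + x ^ 2) ^ 2 ≤ 1 / (2 * b ^ 2) := by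
      rw [div_le_div_iff₀ (by positivity) (by positivity)]
      nlinarith [sq_nonneg (b * x), sq_nonneg (x ^ 2)]
    have hC : ε * ((b ^ 2 / 2 - x ^ 2 / 4) / (b ^ 2 + x ^ 2) ^ 2) ≤ m / 2 := by
      calc _ ≤ ε * (1 / (2 * b ^ 2)) := mul_le_mul_of_nonneg_left hB hε.le
        _ ≤ m * b ^ 2 * (1 / (2 * b ^ 2)) := mul_le_mul_of_nonneg_right hεm (by positivity)
        _ = m / 2 := by field_simp
    linarith [hxv hx]
  · have hx2 : 4 * b ^ 2 ≤ x ^ 2 := by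
      have := pow_le_pow_left₀ (by positivity) (not_lt.1 hx) 2
      rw [sq_abs] at this
      linarith
    have hB : 2 / 25 * (1 + x ^ 2)⁻¹ ≤ -((b ^ 2 / 2 - x ^ 2 / 4) / (b ^ 2 + x ^ 2) ^ 2) := by
      rw [← neg_div, ← div_eq_mul_inv, div_le_div_iff₀ h1 (by positivity)]
      have hb2 : 0 < b ^ 2 := by positivity
      generalize b ^ 2 = B at *
      generalize x ^ 2 = X at *
      nlinarith [mul_nonneg hb2.le (sub_nonneg.2 hx2), mul_nonneg (sub_nonneg.2 hx2) (sub_nonneg.2 hx2)]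
    have hA : min (ε * (2 / 25)) (m / 2) * (1 + x ^ 2)⁻¹ ≤ ε * (2 / 25) * (1 + x ^ 2)⁻¹ :=
      mul_le_mul_of_nonneg_right (min_le_left _ _) (by positivity)
    have := mul_le_mul_of_nonneg_left hB hε.le
    linarith

/-- An iterated integral over a strip is the integral over the plane if the integrand vanishes off
the strip. -/
theorem integral_strip_eq_integral_prod {F : ℝ × ℝ → ℝ} {I : Set ℝ} (hF : Integrable F)
    (h0 : ∀ s t, t ∉ I → F (s, t) = 0) : ∫ s, ∫ t in I, F (s, t) = ∫ p, F p := by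
  rw [Measure.volume_eq_prod, integral_prod F (by rwa [← Measure.volume_eq_prod])]
  exact integral_congr_ae (.of_forall fun s =>
    setIntegral_eq_integral_of_forall_compl_eq_zero fun t ht => h0 s t ht)

/-- **Theorem (Hardy inequality in geodesic strips).**
For a geodesic strip of half-width `a` on a ruled surface with `σ = τ - θ'`
bounded, continuous, not identically zero and `a * ‖σ‖_∞ < √2`, and any `s₀`
with `σ s₀ ≠ 0`, there is `c > 0` such that for all test functions `ψ`,
`Q₀[ψ] - E₁ ‖ψ‖²_{H₀} ≥ c ‖ρ⁻¹ ψ‖²_{H₀}` with `ρ(s,t) = √(1+(s-s₀)²)`. -/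
theorem hardy_inequality_geodesic_strip
    (a : ℝ) (ha : 0 < a)
    (σ : ℝ → ℝ) (hσcont : Continuous σ) (hσbdd : ∃ M, ∀ s, |σ s| ≤ M)
    (hσne : ∃ s, σ s ≠ 0)
    (hthin : a * (⨆ s, |σ s|) < Real.sqrt 2)
    (s₀ : ℝ) (hs₀ : σ s₀ ≠ 0) :
    ∃ c > (0:ℝ), ∀ ψ : ℝ → ℝ → ℂ,
      ContDiff ℝ (⊤ : ℕ∞) (fun p : ℝ × ℝ => ψ p.1 p.2) →
      HasCompactSupport (fun p : ℝ × ℝ => ψ p.1 p.2) →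
      tsupport (fun p : ℝ × ℝ => ψ p.1 p.2) ⊆ univ ×ˢ Ioo (-a) a →
      ((∫ s : ℝ, ∫ t in Ioo (-a) a,
            (Real.sqrt (1 + t ^ 2 * σ s ^ 2))⁻¹ *
              ‖deriv (fun x => ψ x t) s‖ ^ 2) +
          (∫ s : ℝ, ∫ t in Ioo (-a) a,
            Real.sqrt (1 + t ^ 2 * σ s ^ 2) * ‖deriv (ψ s) t‖ ^ 2)) -
          (π ^ 2 / (2 * a) ^ 2) *
            (∫ s : ℝ, ∫ t in Ioo (-a) a,
              ‖ψ s t‖ ^ 2 * Real.sqrt (1 + t ^ 2 * σ s ^ 2)) ≥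
        c * ∫ s : ℝ, ∫ t in Ioo (-a) a,
              (Real.sqrt (1 + (s - s₀) ^ 2) ^ 2)⁻¹ * ‖ψ s t‖ ^ 2 *
                Real.sqrt (1 + t ^ 2 * σ s ^ 2) := by
  obtain ⟨M, hM⟩ := hσbdd
  set L : ℝ := ⨆ s, |σ s| with hL
  have hσL : ∀ s, |σ s| ≤ L := le_ciSup (f := fun s => |σ s|) ⟨M, by rintro _ ⟨s, rfl⟩; exact hM s⟩
  have hL0 : 0 ≤ L := (abs_nonneg _).trans (hσL 0)
  have hd : (a * L) ^ 2 < 2 := by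
    have := pow_lt_pow_left₀ hthin (by positivity) two_ne_zero
    rwa [Real.sq_sqrt (by norm_num)] at this
  have htσ : ∀ s, ∀ t ∈ Ioo (-a) a, t ^ 2 * σ s ^ 2 ≤ (a * L) ^ 2 := by
    intro s t ht
    rw [← mul_pow, ← sq_abs, abs_mul]
    have : |t| ≤ a := (abs_lt.2 ht).le
    exact pow_le_pow_left₀ (by positivity) (mul_le_mul this (hσL s) (abs_nonneg _) ha.le) 2
  set δ : ℝ := (2 - (a * L) ^ 2) / 32 with hδ
  have hδ0 : 0 < δ := by rw [hδ]; linarith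
  have hm : 0 < σ s₀ ^ 2 / 2 := by positivity
  obtain ⟨r, hr, hσr⟩ : ∃ r > 0, ∀ s, |s - s₀| < r → σ s₀ ^ 2 / 2 < σ s ^ 2 := by
    have h := ((hσcont.pow 2).tendsto s₀).eventually_const_lt
      (show σ s₀ ^ 2 / 2 < σ s₀ ^ 2 by linarith)
    obtain ⟨r, hr, h⟩ := Metric.eventually_nhds_iff.1 h
    exact ⟨r, hr, fun s hs => h (by rwa [Real.dist_eq])⟩
  obtain ⟨ε, hε, hε2, c, hc, hweight⟩ :=
    exists_hardy_weight_le (half_pos hr) (mul_pos hδ0 hm)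
  refine ⟨c / 2, by positivity, fun ψ hψ hψc hψs => ?_⟩
  set Ψ : ℝ × ℝ → ℂ := fun p => ψ p.1 p.2 with hΨ
  have hΨ1 : ContDiff ℝ 1 Ψ := hψ.of_le (by exact_mod_cast le_top)
  have hΨd : Differentiable ℝ Ψ := hΨ1.differentiable one_ne_zero
  have hfd : Continuous (fderiv ℝ Ψ) := hΨ1.continuous_fderiv one_ne_zero
  have hD1 : ∀ s t, deriv (fun x => ψ x t) s = fderiv ℝ Ψ (s, t) (1, 0) := fun s t =>
    ((hΨd (s, t)).hasFDerivAt.comp_hasDerivAt (f := fun x => (x, t)) s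
      ((hasDerivAt_id s).prodMk (hasDerivAt_const s t))).deriv
  have hD2 : ∀ s t, deriv (ψ s) t = fderiv ℝ Ψ (s, t) (0, 1) := fun s t =>
    ((hΨd (s, t)).hasFDerivAt.comp_hasDerivAt (f := fun x => (s, x)) t
      ((hasDerivAt_const t s).prodMk (hasDerivAt_id t))).deriv
  have hout : ∀ s t, t ∉ Ioo (-a) a → (s, t) ∉ tsupport Ψ := fun s t ht h => ht (hψs h).2
  have hΨ0 : ∀ s t, t ∉ Ioo (-a) a → Ψ (s, t) = 0 := fun s t ht =>
    image_eq_zero_of_notMem_tsupport (hout s t ht)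
  have hdΨ0 : ∀ s t, t ∉ Ioo (-a) a → fderiv ℝ Ψ (s, t) = 0 := fun s t ht => by
    by_contra h
    exact hout s t ht (support_fderiv_subset ℝ h)
  have hslice1 : ∀ t, HasCompactSupport (fun x => ψ x t) := fun t =>
    HasCompactSupport.intro (hψc.isCompact.image continuous_fst) fun x hx =>
      image_eq_zero_of_notMem_tsupport (f := Ψ) (x := (x, t)) fun h => hx ⟨_, h, rfl⟩
  have hslice2 : ∀ s, tsupport (ψ s) ⊆ Prod.snd '' tsupport Ψ := fun s =>
    closure_minimal (fun t ht => ⟨(s, t), subset_tsupport Ψ ht, rfl⟩)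
      (hψc.isCompact.image continuous_snd).isClosed
  have hslice2' : ∀ s, tsupport (ψ s) ⊆ Ioo (-a) a := fun s t ht => by
    obtain ⟨p, hp, rfl⟩ := hslice2 s ht
    exact (hψs hp).2
  have hslice2c : ∀ s, HasCompactSupport (ψ s) := fun s =>
    (hψc.isCompact.image continuous_snd).of_isClosed_subset (isClosed_tsupport _) (hslice2 s)
  have hint0 : ∀ k : ℝ × ℝ → ℝ, Continuous k → Integrable (fun p => k p * ‖Ψ p‖ ^ 2) :=
    fun k hk => hk.integrable_mul_norm_sq hΨ1.continuous hψc
  have hint1 : ∀ v : ℝ × ℝ, ∀ k : ℝ × ℝ → ℝ, Continuous k →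
      Integrable (fun p => k p * ‖fderiv ℝ Ψ p v‖ ^ 2) := fun v k hk =>
    hk.integrable_mul_norm_sq (hfd.clm_apply continuous_const) (hψc.fderiv_apply ℝ v)
  set h : ℝ × ℝ → ℝ := fun p => √(1 + p.2 ^ 2 * σ p.1 ^ 2) with hh
  have hhc : Continuous h := by rw [hh]; fun_prop
  have hh1 : ∀ p, 1 ≤ h p := fun p =>
    Real.one_le_sqrt.2 (le_add_of_nonneg_right (by positivity))
  have hh0 : ∀ p, 0 < h p := fun p => one_pos.trans_le (hh1 p)
  set q₁ : ℝ × ℝ → ℝ := fun p =>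
    ((r / 2) ^ 2 / 2 - (p.1 - s₀) ^ 2 / 4) / ((r / 2) ^ 2 + (p.1 - s₀) ^ 2) ^ 2 with hq₁
  have hq₁c : Continuous q₁ :=
    Continuous.div (by fun_prop) (by fun_prop) fun p => by positivity
  set V : ℝ × ℝ → ℝ := fun p => σ p.1 ^ 2 * (2 - p.2 ^ 2 * σ p.1 ^ 2) / (4 * h p ^ 3) with hV
  have hVc : Continuous V :=
    Continuous.div (by fun_prop) (by fun_prop) fun p => mul_ne_zero four_ne_zero (pow_pos (hh0 p) 3).ne'
  set E : ℝ := π ^ 2 / (2 * a) ^ 2 with hE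
  have hlongi : Integrable (fun p => ‖fderiv ℝ Ψ p (1, 0)‖ ^ 2 + q₁ p * ‖Ψ p‖ ^ 2) :=
    Integrable.add (by simpa using hint1 (1, 0) (fun _ => 1) continuous_const) (hint0 q₁ hq₁c)
  have htransi : Integrable
      (fun p => h p * ‖fderiv ℝ Ψ p (0, 1)‖ ^ 2 + (-E * h p - V p) * ‖Ψ p‖ ^ 2) :=
    (hint1 (0, 1) h hhc).add (hint0 (fun p => -E * h p - V p) (by fun_prop))
  have hlong : 0 ≤ ∫ p, (‖fderiv ℝ Ψ p (1, 0)‖ ^ 2 + q₁ p * ‖Ψ p‖ ^ 2) := by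
    have hi := hlongi
    rw [Measure.volume_eq_prod] at hi ⊢
    refine le_of_le_of_eq ?_ (integral_prod_symm _ hi).symm
    refine integral_nonneg fun t => ?_
    have := integral_hardy_nonneg (f := fun x => ψ x t)
      (hΨ1.comp (contDiff_id.prodMk contDiff_const)) (hslice1 t) (half_pos hr) s₀
    simp only [hD1] at this
    exact this
  have htrans : 0 ≤ ∫ p, (h p * ‖fderiv ℝ Ψ p (0, 1)‖ ^ 2 + (-E * h p - V p) * ‖Ψ p‖ ^ 2) := by
    have hi := htransi
    rw [Measure.volume_eq_prod] at hi ⊢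
    refine le_of_le_of_eq ?_ (integral_prod _ hi).symm
    refine integral_nonneg fun s => ?_
    have := integral_transverse_nonneg (f := ψ s)
      (hΨ1.comp (contDiff_const.prodMk contDiff_id)) (hslice2c s) ha (hslice2' s) (σ s)
    simp only [hD2] at this
    exact this
  have hk1 : Continuous fun p => (h p)⁻¹ := hhc.inv₀ fun p => (hh0 p).ne'
  have hk2 : Continuous fun p : ℝ × ℝ => (1 + (p.1 - s₀) ^ 2)⁻¹ * h p :=
    (Continuous.inv₀ (by fun_prop) fun p => by positivity).mul hhc
  have e1 : (∫ s : ℝ, ∫ t in Ioo (-a) a, (√(1 + t ^ 2 * σ s ^ 2))⁻¹ *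
      ‖deriv (fun x => ψ x t) s‖ ^ 2) = ∫ p, (h p)⁻¹ * ‖fderiv ℝ Ψ p (1, 0)‖ ^ 2 := by
    simp only [hD1]
    exact integral_strip_eq_integral_prod (hint1 _ _ hk1) fun s t ht => by simp [hdΨ0 s t ht]
  have e2 : (∫ s : ℝ, ∫ t in Ioo (-a) a, √(1 + t ^ 2 * σ s ^ 2) * ‖deriv (ψ s) t‖ ^ 2)
      = ∫ p, h p * ‖fderiv ℝ Ψ p (0, 1)‖ ^ 2 := by
    simp only [hD2]
    exact integral_strip_eq_integral_prod (hint1 _ _ hhc) fun s t ht => by simp [hdΨ0 s t ht]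
  have e3 : (∫ s : ℝ, ∫ t in Ioo (-a) a, ‖ψ s t‖ ^ 2 * √(1 + t ^ 2 * σ s ^ 2))
      = ∫ p, h p * ‖Ψ p‖ ^ 2 := by
    simp only [mul_comm (‖ψ _ _‖ ^ 2)]
    exact integral_strip_eq_integral_prod (hint0 _ hhc) fun s t ht => by simp [hΨ0 s t ht]
  have e4 : (∫ s : ℝ, ∫ t in Ioo (-a) a, (√(1 + (s - s₀) ^ 2) ^ 2)⁻¹ * ‖ψ s t‖ ^ 2 *
      √(1 + t ^ 2 * σ s ^ 2)) = ∫ p, (1 + (p.1 - s₀) ^ 2)⁻¹ * h p * ‖Ψ p‖ ^ 2 := by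
    have hsq : ∀ s : ℝ, √(1 + (s - s₀) ^ 2) ^ 2 = 1 + (s - s₀) ^ 2 :=
      fun s => Real.sq_sqrt (by positivity)
    simp only [hsq, mul_right_comm _ (‖ψ _ _‖ ^ 2)]
    exact integral_strip_eq_integral_prod (hint0 _ hk2) fun s t ht => by simp [hΨ0 s t ht]
  rw [e1, e2, e3, e4]
  have i1 := hint1 (1, 0) _ hk1
  have i2 := hint1 (0, 1) _ hhc
  have i3 := (hint0 _ hhc).const_mul E
  have i4 := (hint0 _ hk2).const_mul (c / 2)
  have i5 := hlongi.const_mul ε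
  have hmono := integral_mono ((i4.add i5).add htransi) ((i1.add i2).sub i3) fun p => ?_
  · rw [integral_add' (i4.add i5) htransi, integral_add' i4 i5, integral_sub' (i1.add i2) i3,
      integral_add' i1 i2, integral_const_mul, integral_const_mul, integral_const_mul] at hmono
    have hl := mul_nonneg hε.le hlong
    linarith
  · obtain ⟨s, t⟩ := p
    simp only [Pi.add_apply, Pi.sub_apply]
    by_cases ht : t ∈ Ioo (-a) a
    · have hts := htσ s t ht
      have hp1 := hh1 (s, t)
      have hp0 := hh0 (s, t)
      have hp2 : h (s, t) ≤ 2 := by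
        refine Real.sqrt_le_iff.2 ⟨by norm_num, ?_⟩
        simp only
        linarith
      have hinv : ε ≤ (h (s, t))⁻¹ := by
        rw [le_inv_comm₀ hε hp0]
        refine hp2.trans ?_
        rw [le_inv_comm₀ two_pos hε]
        linarith
      have hVδ : δ * σ s ^ 2 ≤ V (s, t) := by
        rw [hV, le_div_iff₀ (by positivity)]
        have h3 : h (s, t) ^ 3 ≤ 2 ^ 3 := pow_le_pow_left₀ hp0.le hp2 3
        calc δ * σ s ^ 2 * (4 * h (s, t) ^ 3) ≤ δ * σ s ^ 2 * (4 * 2 ^ 3) := by gcongr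
          _ = σ s ^ 2 * (2 - (a * L) ^ 2) := by rw [hδ]; ring
          _ ≤ σ s ^ 2 * (2 - t ^ 2 * σ s ^ 2) := by gcongr
      have hw := hweight (s - s₀) (V (s, t)) (le_trans (by positivity) hVδ) fun hx =>
        le_trans (by
          have := hσr s (by linarith)
          gcongr) hVδ
      change c * (1 + (s - s₀) ^ 2)⁻¹ ≤ -(ε * q₁ (s, t)) + V (s, t) at hw
      have hwh : c / 2 * ((1 + (s - s₀) ^ 2)⁻¹ * h (s, t)) ≤ c * (1 + (s - s₀) ^ 2)⁻¹ := by
        have : 0 ≤ c / 2 * (1 + (s - s₀) ^ 2)⁻¹ := by positivity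
        nlinarith [mul_le_mul_of_nonneg_left hp2 this]
      have hA := mul_le_mul_of_nonneg_right hinv (sq_nonneg ‖fderiv ℝ Ψ (s, t) (1, 0)‖)
      have hB := mul_le_mul_of_nonneg_right (hwh.trans hw) (sq_nonneg ‖Ψ (s, t)‖)
      linarith
    · simp [hΨ0 s t ht, hdΨ0 s t ht]
end

section
/- Let a > 0 and let σ : ℝ → ℝ be bounded and continuous. Let I ⊂ ℝ be any bounded interval of positive length with centre s₀, let χ_I denote the characteristic function of I × (−a,a), and set ρ(s,t) := √(1 + (s − s₀)²). Then for every ψ ∈ C_c^∞(ℝ × (−a,a)): (1 + a²‖σ‖_∞²)^{-1/2} · ∫_{ℝ×(−a,a)} ρ^{-2}|ψ|² h₀ ds dt ≤ 16·(1 + a²‖σ‖_∞²)^{1/2} · ∫_{ℝ×(−a,a)} h₀^{-1}|∂_s ψ|² ds dt + (2 + 64/|I|²) · ∫_{ℝ×(−a,a)} χ_I |ψ|² h₀ ds dt, where |I| is the length of I. -/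
open MeasureTheory Real Set

/-- A Riccati-type inequality: the weight `g x = -x / (4 x² + b²)` satisfies
`16 (g' - g²) ≥ (1 + x²)⁻¹` off `[-b, b]`, with a bounded loss on `[-b, b]`. -/
lemma riccati_weight_bound {b : ℝ} (hb : 0 < b) (x : ℝ) :
    (1 + x ^ 2)⁻¹ ≤ 16 * ((4 * x ^ 2 - b ^ 2) / (4 * x ^ 2 + b ^ 2) ^ 2
        - (-x / (4 * x ^ 2 + b ^ 2)) ^ 2) +
      (2 + 64 / (2 * b) ^ 2) * (Icc (-b) b).indicator (fun _ => (1 : ℝ)) x := by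
  have hc : 0 < 4 * x ^ 2 + b ^ 2 := by positivity
  have hg : (4 * x ^ 2 - b ^ 2) / (4 * x ^ 2 + b ^ 2) ^ 2 - (-x / (4 * x ^ 2 + b ^ 2)) ^ 2
      = (3 * x ^ 2 - b ^ 2) / (4 * x ^ 2 + b ^ 2) ^ 2 := by
    field_simp
    ring
  rw [hg]
  by_cases hx : x ∈ Icc (-b) b
  · rw [indicator_of_mem hx]
    have h1 : (1 + x ^ 2)⁻¹ ≤ 1 := inv_le_one_of_one_le₀ (by nlinarith [sq_nonneg x])
    have h2 : -(1 / b ^ 2) ≤ (3 * x ^ 2 - b ^ 2) / (4 * x ^ 2 + b ^ 2) ^ 2 := by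
      rw [← neg_div, div_le_div_iff₀ (by positivity) (by positivity)]
      nlinarith [mul_nonneg (sq_nonneg x) (sq_nonneg b), sq_nonneg (x ^ 2)]
    have h3 : 64 / (2 * b) ^ 2 = 16 * (1 / b ^ 2) := by
      field_simp
      norm_num
    rw [h3]
    linarith
  · rw [indicator_of_notMem hx, mul_zero, add_zero]
    have hbx : b ^ 2 ≤ x ^ 2 := by
      rw [← sq_abs x]
      have : b < |x| := by
        by_contra! h
        exact hx (abs_le.1 h)
      gcongr
    rw [← mul_div_assoc, inv_eq_one_div, div_le_div_iff₀ (by positivity) (by positivity)]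
    have hb2 : 0 < b ^ 2 := by positivity
    nlinarith [mul_nonneg (sub_nonneg.2 hbx) (sub_nonneg.2 hbx),
      mul_nonneg (sub_nonneg.2 hbx) hb2.le, mul_pos hb2 hb2]

/-- Completing the square in the Riccati-type inequality. -/
lemma hardy_pointwise {b : ℝ} (hb : 0 < b) (x : ℝ) (z w : ℂ) :
    (1 + x ^ 2)⁻¹ * ‖z‖ ^ 2 ≤ 16 * ‖w‖ ^ 2 +
      16 * ((4 * x ^ 2 - b ^ 2) / (4 * x ^ 2 + b ^ 2) ^ 2 * ‖z‖ ^ 2 +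
        -x / (4 * x ^ 2 + b ^ 2) * (2 * inner ℝ z w)) +
      (2 + 64 / (2 * b) ^ 2) * ((Icc (-b) b).indicator (fun _ => (1 : ℝ)) x * ‖z‖ ^ 2) := by
  have h1 := mul_le_mul_of_nonneg_right (riccati_weight_bound hb x) (sq_nonneg ‖z‖)
  set g := -x / (4 * x ^ 2 + b ^ 2)
  have h2 : 0 ≤ ‖w‖ ^ 2 + g * (2 * inner ℝ z w) + g ^ 2 * ‖z‖ ^ 2 := by
    have h := norm_add_sq_real w (g • z)
    rw [inner_smul_right, norm_smul, real_inner_comm, mul_pow, Real.norm_eq_abs, sq_abs] at h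
    nlinarith [sq_nonneg ‖w + g • z‖]
  linarith

/-- The derivative of a compactly supported function `g ‖f‖²` has zero integral. -/
lemma integral_deriv_mul_norm_sq_eq_zero {g g' : ℝ → ℝ} (hg : ∀ x, HasDerivAt g (g' x) x)
    (hg' : Continuous g') {f f' : ℝ → ℂ} (hf : ∀ x, HasDerivAt f (f' x) x)
    (hf' : Continuous f') (hs : HasCompactSupport f) :
    ∫ x, (g' x * ‖f x‖ ^ 2 + g x * (2 * inner ℝ (f x) (f' x))) = 0 := by
  have hgc : Continuous g := continuous_iff_continuousAt.2 fun x => (hg x).continuousAt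
  have hfc : Continuous f := continuous_iff_continuousAt.2 fun x => (hf x).continuousAt
  refine integral_eq_zero_of_hasDerivAt_of_integrable (f := fun x => g x * ‖f x‖ ^ 2)
    (fun x => (hg x).mul (hf x).norm_sq) ?_ ?_
  · refine Continuous.integrable_of_hasCompactSupport (by fun_prop) ?_
    exact hs.mono fun x hx h => hx (by simp [h])
  · refine Continuous.integrable_of_hasCompactSupport (by fun_prop) ?_
    exact hs.mono fun x hx h => hx (by simp [h])

/-- **Lemma (kinetic-energy Hardy estimate, weighted version).** For any bounded
interval `I = [s₀ - b, s₀ + b]` (centre `s₀`, length `|I| = 2b > 0`) and every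
test function `ψ ∈ C_c^∞(ℝ × (-a,a))`,
`(1+a²‖σ‖_∞²)^{-1/2} ‖ρ⁻¹ψ‖²_{H₀} ≤ 16 (1+a²‖σ‖_∞²)^{1/2} ‖h₀⁻¹∂₁ψ‖²_{H₀}
  + (2 + 64/|I|²) ‖χ_I ψ‖²_{H₀}`. -/
theorem kinetic_hardy_weighted
    (a : ℝ) (ha : 0 < a)
    (σ : ℝ → ℝ) (hσcont : Continuous σ) (hσbdd : ∃ M, ∀ s, |σ s| ≤ M)
    (s₀ b : ℝ) (hb : 0 < b) :
    ∀ ψ : ℝ → ℝ → ℂ,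
      ContDiff ℝ (⊤ : ℕ∞) (fun p : ℝ × ℝ => ψ p.1 p.2) →
      HasCompactSupport (fun p : ℝ × ℝ => ψ p.1 p.2) →
      tsupport (fun p : ℝ × ℝ => ψ p.1 p.2) ⊆ univ ×ˢ Ioo (-a) a →
      (Real.sqrt (1 + a ^ 2 * (⨆ s, |σ s|) ^ 2))⁻¹ *
          (∫ s : ℝ, ∫ t in Ioo (-a) a,
            (1 + (s - s₀) ^ 2)⁻¹ * ‖ψ s t‖ ^ 2 * Real.sqrt (1 + t ^ 2 * σ s ^ 2)) ≤
        16 * Real.sqrt (1 + a ^ 2 * (⨆ s, |σ s|) ^ 2) *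
            (∫ s : ℝ, ∫ t in Ioo (-a) a,
              (Real.sqrt (1 + t ^ 2 * σ s ^ 2))⁻¹ *
                ‖deriv (fun x => ψ x t) s‖ ^ 2) +
          (2 + 64 / (2 * b) ^ 2) *
            (∫ s in Icc (s₀ - b) (s₀ + b), ∫ t in Ioo (-a) a,
              ‖ψ s t‖ ^ 2 * Real.sqrt (1 + t ^ 2 * σ s ^ 2)) := by
  intro ψ hψ hsupp _
  set F : ℝ × ℝ → ℂ := fun p => ψ p.1 p.2
  set F' : ℝ × ℝ → ℂ := fun p => fderiv ℝ F p (1, 0) with hF'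
  have hFc : Continuous F := hψ.continuous
  have hFc' : Continuous F' :=
    (hψ.continuous_fderiv (by simp)).clm_apply continuous_const
  have hsupp' : HasCompactSupport F' :=
    (hsupp.fderiv ℝ).mono fun p hp h => hp (by simp [hF', h])
  have hslice : ∀ s t, HasDerivAt (fun x => ψ x t) (F' (s, t)) s := by
    intro s t
    have h : HasFDerivAt F (fderiv ℝ F (s, t)) (s, t) :=
      (hψ.differentiable (by simp) (s, t)).hasFDerivAt
    exact h.comp_hasDerivAt s ((hasDerivAt_id s).prodMk (hasDerivAt_const s t))
  have hderiv : ∀ s t, deriv (fun x => ψ x t) s = F' (s, t) := fun s t => (hslice s t).deriv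
  simp only [hderiv]
  set A := Real.sqrt (1 + a ^ 2 * (⨆ s, |σ s|) ^ 2)
  set h₀ : ℝ × ℝ → ℝ := fun p => Real.sqrt (1 + p.2 ^ 2 * σ p.1 ^ 2)
  have hh₀_one : ∀ p, 1 ≤ h₀ p := fun p => Real.one_le_sqrt.2 (by
    have : 0 ≤ p.2 ^ 2 * σ p.1 ^ 2 := by positivity
    linarith)
  have hh₀_pos : ∀ p, 0 < h₀ p := fun p => one_pos.trans_le (hh₀_one p)
  have hh₀_ne : ∀ p, h₀ p ≠ 0 := fun p => (hh₀_pos p).ne'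
  have hh₀_le : ∀ p : ℝ × ℝ, p.2 ∈ Ioo (-a) a → h₀ p ≤ A := by
    intro p hp
    have hbdd : BddAbove (range fun s => |σ s|) := by
      obtain ⟨M, hM⟩ := hσbdd
      exact ⟨M, by rintro _ ⟨s, rfl⟩; exact hM s⟩
    have h1 : |σ p.1| ≤ ⨆ s, |σ s| := le_ciSup hbdd p.1
    have h2 : |p.2| ≤ a := abs_le.2 ⟨hp.1.le, hp.2.le⟩
    refine Real.sqrt_le_sqrt ?_
    rw [← sq_abs p.2, ← sq_abs (σ p.1)]
    gcongr
  have hA_pos : 0 < A := Real.sqrt_pos.2 (by positivity)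
  have hh₀c : Continuous h₀ := by fun_prop
  set g : ℝ → ℝ := fun s => -(s - s₀) / (4 * (s - s₀) ^ 2 + b ^ 2)
  set g' : ℝ → ℝ := fun s =>
    (4 * (s - s₀) ^ 2 - b ^ 2) / (4 * (s - s₀) ^ 2 + b ^ 2) ^ 2 with hg'
  have hden : ∀ s : ℝ, 4 * (s - s₀) ^ 2 + b ^ 2 ≠ 0 := fun s => by positivity
  have hgd : ∀ s, HasDerivAt g (g' s) s := by
    intro s
    have h1 : HasDerivAt (fun s : ℝ => s - s₀) 1 s := (hasDerivAt_id s).sub_const s₀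
    refine (h1.neg.div (((h1.pow 2).const_mul 4).add_const (b ^ 2)) (hden s)).congr_deriv ?_
    simp [hg']
    ring
  have hgc' : Continuous g' := by
    refine Continuous.div (by fun_prop) (by fun_prop) fun s => pow_ne_zero 2 (hden s)
  have hgc : Continuous g := Continuous.div (by fun_prop) (by fun_prop) hden
  set ν : Measure ℝ := volume.restrict (Ioo (-a) a) with hν
  set D : ℝ × ℝ → ℝ := fun p =>
    g' p.1 * ‖F p‖ ^ 2 + g p.1 * (2 * inner ℝ (F p) (F' p)) with hD
  have hint : ∀ {u : ℝ × ℝ → ℝ}, Continuous u → HasCompactSupport u →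
      Integrable u (volume.prod ν) := by
    intro u hu hus
    have h := (hu.integrable_of_hasCompactSupport (μ := volume) hus).mono_measure
      (Measure.restrict_le_self (s := univ ×ˢ Ioo (-a) a))
    rwa [Measure.volume_eq_prod, ← Measure.prod_restrict, Measure.restrict_univ] at h
  have hρ : ∀ s : ℝ, 1 + (s - s₀) ^ 2 ≠ 0 := fun s => by positivity
  have i₁ : Integrable (fun p : ℝ × ℝ => (1 + (p.1 - s₀) ^ 2)⁻¹ * ‖F p‖ ^ 2 * h₀ p)
      (volume.prod ν) := by
    refine hint ?_ (hsupp.mono fun p hp h => hp (by simp [h]))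
    have hρc : Continuous fun p : ℝ × ℝ => 1 + (p.1 - s₀) ^ 2 := by fun_prop
    exact ((hρc.inv₀ fun p => hρ p.1).mul (hFc.norm.pow 2)).mul hh₀c
  have i₂ : Integrable (fun p : ℝ × ℝ => (h₀ p)⁻¹ * ‖F' p‖ ^ 2) (volume.prod ν) :=
    hint ((hh₀c.inv₀ hh₀_ne).mul (hFc'.norm.pow 2)) (hsupp'.mono fun p hp h => hp (by simp [h]))
  have i₃ : Integrable (fun p : ℝ × ℝ => ‖F p‖ ^ 2 * h₀ p) (volume.prod ν) :=
    hint (by fun_prop) (hsupp.mono fun p hp h => hp (by simp [h]))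
  have iD : Integrable D (volume.prod ν) :=
    hint (by fun_prop) (hsupp.mono fun p hp h => hp (by simp [hD, h]))
  have hD0 : ∫ p, D p ∂(volume.prod ν) = 0 := by
    rw [integral_prod_symm D iD]
    refine integral_eq_zero_of_ae (Filter.Eventually.of_forall fun t => ?_)
    refine integral_deriv_mul_norm_sq_eq_zero hgd hgc' (fun s => hslice s t)
      (f' := fun s => F' (s, t)) (by fun_prop) ?_
    exact HasCompactSupport.intro (hsupp.image continuous_fst) fun s hs => by
      by_contra h
      exact hs ⟨(s, t), subset_tsupport F h, rfl⟩
  have hmeas : MeasurableSet (Icc (s₀ - b) (s₀ + b) ×ˢ (univ : Set ℝ)) :=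
    measurableSet_Icc.prod .univ
  have e₁ := integral_prod _ i₁
  have e₂ := integral_prod _ i₂
  have e₃ := setIntegral_prod (s := Icc (s₀ - b) (s₀ + b)) (t := univ) _ i₃.integrableOn
  rw [Measure.restrict_univ, ← integral_indicator hmeas] at e₃
  have i₃' := i₃.indicator hmeas
  have j₂ : Integrable (fun p => 16 * A * ((h₀ p)⁻¹ * ‖F' p‖ ^ 2)) (volume.prod ν) :=
    i₂.const_mul _
  have jD : Integrable (fun p => 16 * D p) (volume.prod ν) := iD.const_mul _
  have j₂D : Integrable (fun p => 16 * A * ((h₀ p)⁻¹ * ‖F' p‖ ^ 2) + 16 * D p)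
      (volume.prod ν) := j₂.add jD
  have key : ∫ p, A⁻¹ * ((1 + (p.1 - s₀) ^ 2)⁻¹ * ‖F p‖ ^ 2 * h₀ p) ∂(volume.prod ν) ≤
      ∫ p, (16 * A * ((h₀ p)⁻¹ * ‖F' p‖ ^ 2) + 16 * D p + (2 + 64 / (2 * b) ^ 2) *
        (Icc (s₀ - b) (s₀ + b) ×ˢ (univ : Set ℝ)).indicator
          (fun p => ‖F p‖ ^ 2 * h₀ p) p) ∂(volume.prod ν) := by
    refine integral_mono_ae (i₁.const_mul _)
      (j₂D.add (i₃'.const_mul _)) ?_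
    have hae : ∀ᵐ p ∂(volume.prod ν), p ∈ (univ : Set ℝ) ×ˢ Ioo (-a) a := by
      rw [← Measure.restrict_univ (μ := (volume : Measure ℝ)), hν, Measure.prod_restrict]
      exact ae_restrict_mem (MeasurableSet.univ.prod measurableSet_Ioo)
    filter_upwards [hae] with p hp
    have h := hardy_pointwise hb (p.1 - s₀) (F p) (F' p)
    have hle := hh₀_le p hp.2
    have b₁ : A⁻¹ * ((1 + (p.1 - s₀) ^ 2)⁻¹ * ‖F p‖ ^ 2 * h₀ p) ≤
        (1 + (p.1 - s₀) ^ 2)⁻¹ * ‖F p‖ ^ 2 := by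
      rw [inv_mul_le_iff₀ hA_pos, mul_comm A]
      gcongr
    have b₂ : 16 * ‖F' p‖ ^ 2 ≤ 16 * A * ((h₀ p)⁻¹ * ‖F' p‖ ^ 2) := by
      have : 1 ≤ A * (h₀ p)⁻¹ := by
        rw [← div_eq_mul_inv]
        exact (one_le_div (hh₀_pos p)).2 hle
      nlinarith [mul_le_mul_of_nonneg_right this (sq_nonneg ‖F' p‖)]
    have b₃ : (Icc (-b) b).indicator (fun _ => (1 : ℝ)) (p.1 - s₀) * ‖F p‖ ^ 2 ≤
        (Icc (s₀ - b) (s₀ + b) ×ˢ (univ : Set ℝ)).indicator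
          (fun p => ‖F p‖ ^ 2 * h₀ p) p := by
      by_cases hm : p.1 - s₀ ∈ Icc (-b) b
      · have hm' : p ∈ Icc (s₀ - b) (s₀ + b) ×ˢ (univ : Set ℝ) :=
          ⟨⟨by linarith [hm.1], by linarith [hm.2]⟩, mem_univ _⟩
        rw [indicator_of_mem hm, indicator_of_mem hm', one_mul]
        exact le_mul_of_one_le_right (sq_nonneg _) (hh₀_one p)
      · rw [indicator_of_notMem hm, zero_mul]
        exact indicator_nonneg (fun q _ => mul_nonneg (sq_nonneg _) (hh₀_pos q).le) p
    have b₄ := mul_le_mul_of_nonneg_left b₃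
      (show (0 : ℝ) ≤ 2 + 64 / (2 * b) ^ 2 by positivity)
    exact b₁.trans (h.trans (add_le_add (add_le_add b₂ le_rfl) b₄))
  rw [integral_add j₂D (i₃'.const_mul _), integral_add j₂ jD, integral_const_mul, integral_const_mul,
    integral_const_mul, integral_const_mul, hD0, e₁, e₂, e₃, mul_zero, add_zero] at key
  exact key
end

section
/- Let a > 0 and let σ : ℝ → ℝ be bounded and continuous with σ not identically zero and a·‖σ‖_∞ < √2. Let λ(s) := inf over φ ∈ C_c^∞((−a,a)) \ {0} of (∫_{−a}^a |φ'(t)|² h₀(s,t) dt)/(∫_{−a}^a |φ(t)|² h₀(s,t) dt) − E₁, let I be a closed bounded interval of positive length on which λ is (strictly) positive, let s₀ be the centre of I, and set ρ(s,t) := √(1 + (s − s₀)²). Then for every ψ ∈ C_c^∞(ℝ × (−a,a)): Q₀[ψ] − E₁·∥ψ∥²_{H₀} ≥ c·∫_{ℝ×(−a,a)} ρ^{-2}|ψ|² h₀ ds dt, where c := min{ (min_I λ)/((2 + 64/|I|²)·(1 + a²‖σ‖_∞²)^{1/2}), 1/(16·(1 + a²‖σ‖_∞²)) } > 0. -/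
open MeasureTheory Real Set

/-- The values of the weighted Dirichlet Rayleigh quotient on `(-a, a)` with weight
`√(1 + t² q²)`, over smooth test functions. -/
def rayleighQuotients (a q : ℝ) : Set ℝ :=
  {r : ℝ | ∃ φ : ℝ → ℝ, ContDiff ℝ (⊤ : ℕ∞) φ ∧ HasCompactSupport φ ∧
    tsupport φ ⊆ Ioo (-a) a ∧ φ ≠ 0 ∧
    r = (∫ t in Ioo (-a) a, (deriv φ t) ^ 2 * Real.sqrt (1 + t ^ 2 * q ^ 2)) /
        (∫ t in Ioo (-a) a, (φ t) ^ 2 * Real.sqrt (1 + t ^ 2 * q ^ 2))}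

theorem Continuous.integrableOn_Ioo_real {f : ℝ → ℝ} (hf : Continuous f) (x y : ℝ) :
    IntegrableOn f (Ioo x y) :=
  hf.integrableOn_Icc.mono_set Ioo_subset_Icc_self

theorem continuous_sqrt_weight (q : ℝ) :
    Continuous fun t : ℝ => Real.sqrt (1 + t ^ 2 * q ^ 2) := by
  fun_prop

theorem integrableOn_sq_mul_sqrt_weight {g : ℝ → ℝ} (hg : Continuous g) (x y q : ℝ) :
    IntegrableOn (fun t => (g t) ^ 2 * Real.sqrt (1 + t ^ 2 * q ^ 2)) (Ioo x y) :=
  ((hg.pow 2).mul (continuous_sqrt_weight q)).integrableOn_Ioo_real x y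

theorem rayleighQuotients_nonneg (a q : ℝ) {r : ℝ} (hr : r ∈ rayleighQuotients a q) :
    0 ≤ r := by
  obtain ⟨φ, -, -, -, -, rfl⟩ := hr
  exact div_nonneg (integral_nonneg fun t => by positivity)
    (integral_nonneg fun t => by positivity)

theorem bddBelow_rayleighQuotients (a q : ℝ) : BddBelow (rayleighQuotients a q) :=
  ⟨0, fun _ hr => rayleighQuotients_nonneg a q hr⟩

theorem sqrt_weight_le {a t : ℝ} (ht : t ∈ Ioo (-a) a) (p q : ℝ) :
    Real.sqrt (1 + t ^ 2 * p ^ 2) ≤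
      Real.sqrt (1 + a ^ 2 * |p ^ 2 - q ^ 2|) * Real.sqrt (1 + t ^ 2 * q ^ 2) := by
  rw [← Real.sqrt_mul (by positivity)]
  apply Real.sqrt_le_sqrt
  have h1 : t ^ 2 ≤ a ^ 2 := by nlinarith [ht.1, ht.2]
  have h2 : p ^ 2 - q ^ 2 ≤ |p ^ 2 - q ^ 2| := le_abs_self _
  have h3 : 0 ≤ |p ^ 2 - q ^ 2| := abs_nonneg _
  have h4 : 0 ≤ a ^ 2 * |p ^ 2 - q ^ 2| * (t ^ 2 * q ^ 2) := by positivity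
  have h5 := mul_le_mul_of_nonneg_left h2 (sq_nonneg t)
  have h6 := mul_le_mul_of_nonneg_right h1 h3
  nlinarith

theorem integral_mul_sqrt_weight_le {g : ℝ → ℝ} (hg : Continuous g) (a p q : ℝ) :
    ∫ t in Ioo (-a) a, (g t) ^ 2 * Real.sqrt (1 + t ^ 2 * p ^ 2) ≤
      Real.sqrt (1 + a ^ 2 * |p ^ 2 - q ^ 2|) *
        ∫ t in Ioo (-a) a, (g t) ^ 2 * Real.sqrt (1 + t ^ 2 * q ^ 2) := by
  rw [← integral_const_mul]
  refine setIntegral_mono_on (integrableOn_sq_mul_sqrt_weight hg _ _ p)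
    ((integrableOn_sq_mul_sqrt_weight hg _ _ q).const_mul _) measurableSet_Ioo fun t ht => ?_
  have := mul_le_mul_of_nonneg_left (sqrt_weight_le ht p q) (sq_nonneg (g t))
  linarith

theorem sInf_rayleighQuotients_le (a p q : ℝ) :
    sInf (rayleighQuotients a p) ≤
      (1 + a ^ 2 * |p ^ 2 - q ^ 2|) * sInf (rayleighQuotients a q) := by
  rcases (rayleighQuotients a q).eq_empty_or_nonempty with h | h
  · have : rayleighQuotients a p = ∅ := by
      rw [eq_empty_iff_forall_notMem] at h ⊢
      rintro r ⟨φ, h1, h2, h3, h4, -⟩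
      exact h _ ⟨φ, h1, h2, h3, h4, rfl⟩
    simp [h, this]
  · have hK : 0 < 1 + a ^ 2 * |p ^ 2 - q ^ 2| := by positivity
    rw [← div_le_iff₀' hK]
    refine le_csInf h ?_
    rintro r ⟨φ, h1, h2, h3, h4, rfl⟩
    rw [div_le_iff₀' hK]
    refine (csInf_le (bddBelow_rayleighQuotients a p) ⟨φ, h1, h2, h3, h4, rfl⟩).trans ?_
    have hd : Continuous (deriv φ) := h1.continuous_deriv (by simp)
    have hN := integral_mul_sqrt_weight_le hd a p q
    have hD := integral_mul_sqrt_weight_le h1.continuous a q p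
    have hD' := integral_mul_sqrt_weight_le h1.continuous a p q
    have hDp : 0 ≤ ∫ t in Ioo (-a) a, (φ t) ^ 2 * Real.sqrt (1 + t ^ 2 * p ^ 2) :=
      integral_nonneg fun t => by positivity
    have hDq : 0 ≤ ∫ t in Ioo (-a) a, (φ t) ^ 2 * Real.sqrt (1 + t ^ 2 * q ^ 2) :=
      integral_nonneg fun t => by positivity
    have hNq : 0 ≤ ∫ t in Ioo (-a) a, (deriv φ t) ^ 2 * Real.sqrt (1 + t ^ 2 * q ^ 2) :=
      integral_nonneg fun t => by positivity
    rw [abs_sub_comm] at hD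
    have hsq := Real.sq_sqrt hK.le
    have hsp := Real.sqrt_pos.2 hK
    generalize Real.sqrt (1 + a ^ 2 * |p ^ 2 - q ^ 2|) = k at *
    generalize (∫ t in Ioo (-a) a, (φ t) ^ 2 * Real.sqrt (1 + t ^ 2 * p ^ 2)) = Dp at *
    generalize (∫ t in Ioo (-a) a, (φ t) ^ 2 * Real.sqrt (1 + t ^ 2 * q ^ 2)) = Dq at *
    generalize (∫ t in Ioo (-a) a, (deriv φ t) ^ 2 * Real.sqrt (1 + t ^ 2 * p ^ 2)) = Np at *
    generalize (∫ t in Ioo (-a) a, (deriv φ t) ^ 2 * Real.sqrt (1 + t ^ 2 * q ^ 2)) = Nq at *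
    rw [← hsq]
    rcases hDq.eq_or_lt with h0 | h0
    · have : Dp = 0 := by
        rw [← h0] at hD'
        linarith
      simp [← h0, this]
    · have hp : 0 < Dp := by
        by_contra hcon
        have : Dp = 0 := by linarith
        rw [this] at hD
        linarith
      rw [mul_div_assoc', div_le_div_iff₀ hp h0]
      calc Np * Dq ≤ (k * Nq) * (k * Dp) := by gcongr
        _ = k ^ 2 * Nq * Dp := by ring

theorem continuous_sInf_rayleighQuotients (a : ℝ) :
    Continuous fun q => sInf (rayleighQuotients a q) := by
  rw [continuous_iff_continuousAt]
  intro q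
  have hc : Continuous fun p : ℝ => 1 + a ^ 2 * |p ^ 2 - q ^ 2| := by fun_prop
  have hpos : ∀ p : ℝ, 0 < 1 + a ^ 2 * |p ^ 2 - q ^ 2| := fun p => by positivity
  have lower : Filter.Tendsto
      (fun p : ℝ => sInf (rayleighQuotients a q) / (1 + a ^ 2 * |p ^ 2 - q ^ 2|)) (nhds q)
      (nhds (sInf (rayleighQuotients a q))) := by
    have : Continuous fun p : ℝ =>
        sInf (rayleighQuotients a q) / (1 + a ^ 2 * |p ^ 2 - q ^ 2|) :=
      continuous_const.div hc fun p => (hpos p).ne'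
    simpa using this.tendsto q
  have upper : Filter.Tendsto
      (fun p : ℝ => (1 + a ^ 2 * |p ^ 2 - q ^ 2|) * sInf (rayleighQuotients a q)) (nhds q)
      (nhds (sInf (rayleighQuotients a q))) := by
    have : Continuous fun p : ℝ =>
        (1 + a ^ 2 * |p ^ 2 - q ^ 2|) * sInf (rayleighQuotients a q) :=
      hc.mul continuous_const
    simpa using this.tendsto q
  refine tendsto_of_tendsto_of_tendsto_of_le_of_le lower upper (fun p => ?_)
    fun p => sInf_rayleighQuotients_le a p q
  simp only
  rw [div_le_iff₀' (hpos p), abs_sub_comm]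
  exact sInf_rayleighQuotients_le a q p

theorem hasDerivAt_sqrt_weight (q t : ℝ) :
    HasDerivAt (fun t : ℝ => Real.sqrt (1 + t ^ 2 * q ^ 2))
      (t * q ^ 2 / Real.sqrt (1 + t ^ 2 * q ^ 2)) t := by
  have h := (((hasDerivAt_pow 2 t).mul_const (q ^ 2)).const_add 1).sqrt
    (by positivity : (1 + t ^ 2 * q ^ 2) ≠ 0)
  convert h using 1
  field_simp
  norm_num
  ring

/-- The drift `h · (log g)′` of the ground state substitution with
`g = h^{-1/2} cos (k t)`, `h = √(1 + t² q²)`. -/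
noncomputable def groundStateDrift (k q t : ℝ) : ℝ :=
  -(t * q ^ 2 / Real.sqrt (1 + t ^ 2 * q ^ 2)) / 2 -
    k * (Real.sqrt (1 + t ^ 2 * q ^ 2) * Real.tan (k * t))

theorem exists_hasDerivAt_groundStateDrift {k q t : ℝ} (hq : t ^ 2 * q ^ 2 ≤ 2)
    (hc : Real.cos (k * t) ≠ 0) :
    ∃ w', HasDerivAt (groundStateDrift k q) w' t ∧
      w' + groundStateDrift k q t ^ 2 / Real.sqrt (1 + t ^ 2 * q ^ 2) ≤
        -(k ^ 2 * Real.sqrt (1 + t ^ 2 * q ^ 2)) := by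
  have hH := hasDerivAt_sqrt_weight q t
  have hpos : 0 < Real.sqrt (1 + t ^ 2 * q ^ 2) := Real.sqrt_pos.2 (by positivity)
  have hT : HasDerivAt (fun t => Real.tan (k * t)) (1 / Real.cos (k * t) ^ 2 * (k * 1)) t :=
    (Real.hasDerivAt_tan hc).comp t ((hasDerivAt_id t).const_mul k)
  have h1 := ((((hasDerivAt_id t).mul_const (q ^ 2)).div hH hpos.ne').neg.div_const 2).sub
    ((hH.mul hT).const_mul k)
  refine ⟨_, h1, ?_⟩
  have hsec : 1 / Real.cos (k * t) ^ 2 = 1 + Real.tan (k * t) ^ 2 := by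
    rw [Real.tan_eq_sin_div_cos]
    field_simp
    linarith [Real.sin_sq_add_cos_sq (k * t)]
  have hsq : Real.sqrt (1 + t ^ 2 * q ^ 2) ^ 2 = 1 + t ^ 2 * q ^ 2 :=
    Real.sq_sqrt (by positivity)
  rw [hsec]
  simp only [groundStateDrift, id]
  generalize Real.tan (k * t) = T at *
  generalize Real.sqrt (1 + t ^ 2 * q ^ 2) = H at *
  rw [← sub_nonneg]
  have key : 0 ≤ (q ^ 2 * (2 - t ^ 2 * q ^ 2)) / (4 * H ^ 3) := by
    have : 0 ≤ 2 - t ^ 2 * q ^ 2 := by linarith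
    positivity
  convert key using 1
  field_simp
  linear_combination (8 * q ^ 2) * hsq

theorem eventually_eq_zero_of_notMem_tsupport {φ : ℝ → ℝ} {t : ℝ} (ht : t ∉ tsupport φ) :
    ∀ᶠ x in nhds t, φ x = 0 :=
  notMem_tsupport_iff_eventuallyEq.1 ht

/-- The weighted Poincaré inequality: the bottom of the transverse spectrum is at least that
of the unweighted Dirichlet problem as soon as `a² q² ≤ 2`. -/
theorem weighted_poincare {a q : ℝ} (ha : 0 < a) (hq : a ^ 2 * q ^ 2 ≤ 2) {φ : ℝ → ℝ}
    (hφ : ContDiff ℝ (⊤ : ℕ∞) φ) (hsupp : tsupport φ ⊆ Ioo (-a) a) :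
    (π ^ 2 / (2 * a) ^ 2) * ∫ t in Ioo (-a) a, (φ t) ^ 2 * Real.sqrt (1 + t ^ 2 * q ^ 2) ≤
      ∫ t in Ioo (-a) a, (deriv φ t) ^ 2 * Real.sqrt (1 + t ^ 2 * q ^ 2) := by
  have hd : Continuous (deriv φ) := hφ.continuous_deriv (by simp)
  have hN : Continuous fun t => (deriv φ t) ^ 2 * Real.sqrt (1 + t ^ 2 * q ^ 2) :=
    (hd.pow 2).mul (continuous_sqrt_weight q)
  have hD : Continuous fun t => (φ t) ^ 2 * Real.sqrt (1 + t ^ 2 * q ^ 2) :=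
    (hφ.continuous.pow 2).mul (continuous_sqrt_weight q)
  set k := π / (2 * a) with hk
  have hkey : k ^ 2 = π ^ 2 / (2 * a) ^ 2 := by rw [hk, div_pow]
  rw [← hkey, ← sub_nonneg, ← integral_const_mul, ← integral_sub
    (hN.integrableOn_Ioo_real _ _) ((hD.const_mul _).integrableOn_Ioo_real _ _),
    ← integral_Ioc_eq_integral_Ioo,
    ← intervalIntegral.integral_of_le (by linarith)]
  have hcos : ∀ t ∈ Ioo (-a) a, Real.cos (k * t) ≠ 0 := by
    intro t ht
    have hka : k * a = π / 2 := by
      rw [hk]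
      field_simp
    have hk0 : 0 < k := by positivity
    refine (Real.cos_pos_of_mem_Ioo ⟨?_, ?_⟩).ne'
    · nlinarith [ht.1]
    · nlinarith [ht.2]
  have hqt : ∀ t ∈ Ioo (-a) a, t ^ 2 * q ^ 2 ≤ 2 := by
    intro t ht
    have : t ^ 2 ≤ a ^ 2 := by nlinarith [ht.1, ht.2]
    nlinarith [sq_nonneg q]
  have hderiv : ∀ t ∈ Ioo (-a) a, ∃ g', HasDerivAt
      (fun x => groundStateDrift k q x * φ x ^ 2) g' t ∧
      g' ≤ (deriv φ t) ^ 2 * Real.sqrt (1 + t ^ 2 * q ^ 2) -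
        k ^ 2 * ((φ t) ^ 2 * Real.sqrt (1 + t ^ 2 * q ^ 2)) := by
    intro t ht
    obtain ⟨w', hw, hle⟩ := exists_hasDerivAt_groundStateDrift (hqt t ht) (hcos t ht)
    have hφt : HasDerivAt φ (deriv φ t) t :=
      (hφ.differentiable (by simp)).differentiableAt.hasDerivAt
    refine ⟨_, hw.mul (hφt.pow 2), ?_⟩
    have hpos : 0 < Real.sqrt (1 + t ^ 2 * q ^ 2) := Real.sqrt_pos.2 (by positivity)
    generalize Real.sqrt (1 + t ^ 2 * q ^ 2) = H at *
    generalize groundStateDrift k q t = w at *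
    generalize deriv φ t = d at *
    have hs : 0 ≤ H * (d - w / H * φ t) ^ 2 := by positivity
    have he : H * (d - w / H * φ t) ^ 2 = d ^ 2 * H - 2 * w * φ t * d
        + w ^ 2 / H * φ t ^ 2 := by
      field_simp
      ring
    have hm := mul_le_mul_of_nonneg_right hle (sq_nonneg (φ t))
    rw [he] at hs
    norm_num
    nlinarith
  have hzero : ∀ t, t ∉ Ioo (-a) a → t ∉ tsupport φ := fun t ht h => ht (hsupp h)
  have hz : ∀ t, t ∉ Ioo (-a) a → φ t = 0 := fun t ht =>
    image_eq_zero_of_notMem_tsupport (hzero t ht)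
  have hcont : ContinuousOn (fun x => groundStateDrift k q x * φ x ^ 2) (Icc (-a) a) := by
    intro t _
    by_cases ht : t ∈ Ioo (-a) a
    · obtain ⟨_, h, -⟩ := hderiv t ht
      exact h.continuousAt.continuousWithinAt
    · refine ContinuousAt.continuousWithinAt ?_
      have : (fun x => groundStateDrift k q x * φ x ^ 2) =ᶠ[nhds t] fun _ => 0 := by
        filter_upwards [eventually_eq_zero_of_notMem_tsupport (hzero t ht)] with x hx
        simp [hx]
      exact continuousAt_const.congr this.symm
  choose! g' hg' hle using hderiv
  have hfin := intervalIntegral.sub_le_integral_of_hasDeriv_right_of_le (by linarith) hcont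
    (fun t ht => (hg' t ht).hasDerivWithinAt)
    (hN.sub (hD.const_mul _)).integrableOn_Icc (fun t ht => hle t ht)
  rw [hz a (by simp), hz (-a) (by simp)] at hfin
  simpa using hfin

theorem sInf_rayleighQuotients_mul_le (a q : ℝ) {φ : ℝ → ℝ}
    (hφ : ContDiff ℝ (⊤ : ℕ∞) φ) (hc : HasCompactSupport φ) (hsupp : tsupport φ ⊆ Ioo (-a) a) :
    sInf (rayleighQuotients a q) *
        ∫ t in Ioo (-a) a, (φ t) ^ 2 * Real.sqrt (1 + t ^ 2 * q ^ 2) ≤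
      ∫ t in Ioo (-a) a, (deriv φ t) ^ 2 * Real.sqrt (1 + t ^ 2 * q ^ 2) := by
  have hN : 0 ≤ ∫ t in Ioo (-a) a, (deriv φ t) ^ 2 * Real.sqrt (1 + t ^ 2 * q ^ 2) :=
    integral_nonneg fun t => by positivity
  have hD : 0 ≤ ∫ t in Ioo (-a) a, (φ t) ^ 2 * Real.sqrt (1 + t ^ 2 * q ^ 2) :=
    integral_nonneg fun t => by positivity
  rcases hD.eq_or_lt with h | h
  · rw [← h, mul_zero]
    exact hN
  · rw [← le_div_iff₀ h]
    refine csInf_le (bddBelow_rayleighQuotients a q) ⟨φ, hφ, hc, hsupp, ?_, rfl⟩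
    rintro rfl
    simp at h

/-- A weighted inequality of Poincaré type for real functions extends to complex functions. -/
theorem weighted_inequality_complex {a q M : ℝ}
    (h : ∀ φ : ℝ → ℝ, ContDiff ℝ (⊤ : ℕ∞) φ → HasCompactSupport φ → tsupport φ ⊆ Ioo (-a) a →
      M * ∫ t in Ioo (-a) a, (φ t) ^ 2 * Real.sqrt (1 + t ^ 2 * q ^ 2) ≤
        ∫ t in Ioo (-a) a, (deriv φ t) ^ 2 * Real.sqrt (1 + t ^ 2 * q ^ 2))
    {f : ℝ → ℂ} (hf : ContDiff ℝ (⊤ : ℕ∞) f) (hc : HasCompactSupport f)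
    (hsupp : tsupport f ⊆ Ioo (-a) a) :
    M * ∫ t in Ioo (-a) a, ‖f t‖ ^ 2 * Real.sqrt (1 + t ^ 2 * q ^ 2) ≤
      ∫ t in Ioo (-a) a, Real.sqrt (1 + t ^ 2 * q ^ 2) * ‖deriv f t‖ ^ 2 := by
  have hre : ContDiff ℝ (⊤ : ℕ∞) fun t => (f t).re := Complex.reCLM.contDiff.comp hf
  have him : ContDiff ℝ (⊤ : ℕ∞) fun t => (f t).im := Complex.imCLM.contDiff.comp hf
  have hft : ∀ t, HasDerivAt f (deriv f t) t := fun t =>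
    (hf.differentiable (by simp)).differentiableAt.hasDerivAt
  have dre : deriv (fun t => (f t).re) = fun t => (deriv f t).re := by
    funext t
    exact (Complex.reCLM.hasFDerivAt.comp_hasDerivAt t (hft t)).deriv
  have dim : deriv (fun t => (f t).im) = fun t => (deriv f t).im := by
    funext t
    exact (Complex.imCLM.hasFDerivAt.comp_hasDerivAt t (hft t)).deriv
  have h1 := h _ hre (hc.comp_left (g := Complex.re) rfl)
    ((tsupport_comp_subset (g := Complex.re) rfl f).trans hsupp)
  have h2 := h _ him (hc.comp_left (g := Complex.im) rfl)
    ((tsupport_comp_subset (g := Complex.im) rfl f).trans hsupp)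
  rw [dre] at h1
  rw [dim] at h2
  have hd : Continuous (deriv f) := hf.continuous_deriv (by simp)
  have cre : Continuous fun t => (deriv f t).re := Complex.continuous_re.comp hd
  have cim : Continuous fun t => (deriv f t).im := Complex.continuous_im.comp hd
  have hn : ∀ z : ℂ, ‖z‖ ^ 2 = z.re ^ 2 + z.im ^ 2 := fun z => by
    rw [Complex.sq_norm, Complex.normSq_apply]
    ring
  have e1 : ∫ t in Ioo (-a) a, ‖f t‖ ^ 2 * Real.sqrt (1 + t ^ 2 * q ^ 2) =
      (∫ t in Ioo (-a) a, (f t).re ^ 2 * Real.sqrt (1 + t ^ 2 * q ^ 2)) +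
        ∫ t in Ioo (-a) a, (f t).im ^ 2 * Real.sqrt (1 + t ^ 2 * q ^ 2) := by
    rw [← integral_add
      (integrableOn_sq_mul_sqrt_weight hre.continuous _ _ q)
      (integrableOn_sq_mul_sqrt_weight him.continuous _ _ q)]
    simp_rw [hn, add_mul]
  have e2 : ∫ t in Ioo (-a) a, Real.sqrt (1 + t ^ 2 * q ^ 2) * ‖deriv f t‖ ^ 2 =
      (∫ t in Ioo (-a) a, (deriv f t).re ^ 2 * Real.sqrt (1 + t ^ 2 * q ^ 2)) +
        ∫ t in Ioo (-a) a, (deriv f t).im ^ 2 * Real.sqrt (1 + t ^ 2 * q ^ 2) := by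
    rw [← integral_add
      (integrableOn_sq_mul_sqrt_weight cre _ _ q)
      (integrableOn_sq_mul_sqrt_weight cim _ _ q)]
    simp_rw [hn, mul_add, mul_comm (Real.sqrt _)]
  rw [e1, e2]
  linarith

/-- A pointwise form of the local Hardy inequality: the drift `x ↦ 4 x / (x² + b²/4)` has
divergence dominating the Hardy weight up to a local term. -/
theorem hardy_drift_le {b : ℝ} (hb : 0 < b) (x : ℝ) :
    (4 * (x ^ 2 + b ^ 2 / 4) - 4 * x * (2 * x)) / (x ^ 2 + b ^ 2 / 4) ^ 2 +
        (4 * x / (x ^ 2 + b ^ 2 / 4)) ^ 2 / 16 ≤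
      (Icc (-b) b).indicator (fun _ => 2 + 64 / (2 * b) ^ 2) x - (1 + x ^ 2)⁻¹ := by
  have hP : 0 < x ^ 2 + b ^ 2 / 4 := by positivity
  have he : (4 * (x ^ 2 + b ^ 2 / 4) - 4 * x * (2 * x)) / (x ^ 2 + b ^ 2 / 4) ^ 2 +
        (4 * x / (x ^ 2 + b ^ 2 / 4)) ^ 2 / 16 =
      (b ^ 2 - 3 * x ^ 2) / (x ^ 2 + b ^ 2 / 4) ^ 2 := by
    field_simp
    ring
  rw [he]
  by_cases hx : x ∈ Icc (-b) b
  · rw [indicator_of_mem hx]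
    have h1 : (1 + x ^ 2)⁻¹ ≤ 1 := inv_le_one_of_one_le₀ (by nlinarith)
    have h2 : (b ^ 2 - 3 * x ^ 2) / (x ^ 2 + b ^ 2 / 4) ^ 2 ≤ 64 / (2 * b) ^ 2 := by
      rw [div_le_div_iff₀ (by positivity) (by positivity)]
      nlinarith [mul_nonneg (sq_nonneg x) (sq_nonneg b), sq_nonneg (x ^ 2)]
    linarith
  · rw [indicator_of_notMem hx]
    have hxb : b ^ 2 ≤ x ^ 2 := by
      rw [mem_Icc, ← abs_le, not_le] at hx
      rw [← sq_abs x]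
      nlinarith
    have hx0 : 0 < x ^ 2 := lt_of_lt_of_le (by positivity) hxb
    have h1 : (1 + x ^ 2)⁻¹ ≤ (x ^ 2)⁻¹ := inv_anti₀ hx0 (by linarith)
    have h2 : (x ^ 2)⁻¹ ≤ (3 * x ^ 2 - b ^ 2) / (x ^ 2 + b ^ 2 / 4) ^ 2 := by
      rw [inv_eq_one_div, div_le_div_iff₀ hx0 (by positivity)]
      nlinarith [mul_nonneg (sub_nonneg.2 hxb) hx0.le,
        mul_nonneg (sub_nonneg.2 hxb) (sq_nonneg b)]
    have h3 : (b ^ 2 - 3 * x ^ 2) / (x ^ 2 + b ^ 2 / 4) ^ 2 =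
        -((3 * x ^ 2 - b ^ 2) / (x ^ 2 + b ^ 2 / 4) ^ 2) := by
      rw [← neg_div]
      ring
    linarith

theorem hardy_local {b : ℝ} (hb : 0 < b) (s₀ : ℝ) {f : ℝ → ℂ} (hf : ContDiff ℝ 1 f)
    (hc : HasCompactSupport f) :
    0 ≤ ∫ s, (16 * ‖deriv f s‖ ^ 2 +
      (Icc (s₀ - b) (s₀ + b)).indicator (fun _ => 2 + 64 / (2 * b) ^ 2) s * ‖f s‖ ^ 2 -
        (1 + (s - s₀) ^ 2)⁻¹ * ‖f s‖ ^ 2) := by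
  have hd : Continuous (deriv f) := hf.continuous_deriv le_rfl
  have hfc := hf.continuous
  have hP : ∀ s, 0 < (s - s₀) ^ 2 + b ^ 2 / 4 := fun s => by positivity
  have hcsq : HasCompactSupport fun s => ‖f s‖ ^ 2 :=
    hc.comp_left (g := fun z => ‖z‖ ^ 2) (by simp)
  have hdsq : HasCompactSupport fun s => ‖deriv f s‖ ^ 2 :=
    hc.deriv.comp_left (g := fun z => ‖z‖ ^ 2) (by simp)
  have cn : Continuous fun s => ‖f s‖ ^ 2 := hfc.norm.pow 2
  have isq : Integrable fun s => ‖f s‖ ^ 2 :=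
    cn.integrable_of_hasCompactSupport hcsq
  set w : ℝ → ℝ := fun s => 4 * (s - s₀) / ((s - s₀) ^ 2 + b ^ 2 / 4) with hw
  set w' : ℝ → ℝ := fun s => (4 * ((s - s₀) ^ 2 + b ^ 2 / 4) - 4 * (s - s₀) * (2 * (s - s₀))) /
    ((s - s₀) ^ 2 + b ^ 2 / 4) ^ 2 with hw'
  have hwc : Continuous w := Continuous.div (by fun_prop) (by fun_prop) fun s => (hP s).ne'
  have hwc' : Continuous w' :=
    Continuous.div (by fun_prop) (by fun_prop) fun s => (pow_pos (hP s) 2).ne'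
  have hwd : ∀ s, HasDerivAt w (w' s) s := by
    intro s
    have h1 := ((hasDerivAt_id s).sub_const s₀).const_mul 4
    have h2 := (((hasDerivAt_id s).sub_const s₀).pow 2).add_const (b ^ 2 / 4)
    exact (h1.div h2 (hP s).ne').congr_deriv (by simp [hw'])
  have hder : ∀ s, HasDerivAt (fun s => w s * ‖f s‖ ^ 2)
      (w' s * ‖f s‖ ^ 2 + w s * (2 * inner ℝ (f s) (deriv f s))) s := fun s =>
    (hwd s).mul ((hf.differentiable (by simp)).differentiableAt.hasDerivAt.norm_sq)
  have hint : Integrable fun s => w' s * ‖f s‖ ^ 2 + w s * (2 * inner ℝ (f s) (deriv f s)) := by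
    refine Continuous.integrable_of_hasCompactSupport
      ((hwc'.mul cn).add (hwc.mul ((hfc.inner hd).const_mul 2))) ?_
    refine hc.mono fun s hs => ?_
    contrapose! hs
    simp only [Function.mem_support, not_not] at hs ⊢
    simp [hs]
  have hzero := integral_eq_zero_of_hasDerivAt_of_integrable hder hint
    ((hwc.mul cn).integrable_of_hasCompactSupport hcsq.mul_left)
  refine hzero.symm.trans_le (integral_mono hint ?_ fun s => ?_)
  · refine Integrable.sub (Integrable.add ?_ ?_) ?_
    · exact ((hd.norm.pow 2).const_mul 16).integrable_of_hasCompactSupport hdsq.mul_left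
    · have : (fun s => (Icc (s₀ - b) (s₀ + b)).indicator (fun _ => 2 + 64 / (2 * b) ^ 2) s
          * ‖f s‖ ^ 2) = (Icc (s₀ - b) (s₀ + b)).indicator
            fun s => (2 + 64 / (2 * b) ^ 2) * ‖f s‖ ^ 2 := by
        funext s
        by_cases hs : s ∈ Icc (s₀ - b) (s₀ + b)
        · rw [indicator_of_mem hs, indicator_of_mem hs]
        · rw [indicator_of_notMem hs, indicator_of_notMem hs, zero_mul]
      rw [this]
      exact (isq.const_mul _).indicator measurableSet_Icc
    · refine Continuous.integrable_of_hasCompactSupport ?_ hcsq.mul_left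
      refine Continuous.mul (Continuous.inv₀ (by fun_prop) fun s => ?_) cn
      positivity
  · have hI : (Icc (s₀ - b) (s₀ + b)).indicator (fun _ => 2 + 64 / (2 * b) ^ 2) s =
        (Icc (-b) b).indicator (fun _ => 2 + 64 / (2 * b) ^ 2) (s - s₀) := by
      have : s ∈ Icc (s₀ - b) (s₀ + b) ↔ s - s₀ ∈ Icc (-b) b := by
        simp only [mem_Icc]
        constructor <;> rintro ⟨h1, h2⟩ <;> constructor <;> linarith
      simp only [indicator_apply, this]
    have hk := mul_le_mul_of_nonneg_right (hardy_drift_le hb (s - s₀)) (sq_nonneg ‖f s‖)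
    rw [hI]
    have hin := real_inner_le_norm (F := ℂ) (w s • f s) (deriv f s)
    rw [real_inner_smul_left, norm_smul] at hin
    have hwn : ‖w s‖ ^ 2 = w s ^ 2 := by simp
    have hsq := sq_nonneg (4 * ‖deriv f s‖ - ‖w s‖ * ‖f s‖ / 4)
    have e1 : (w s) ^ 2 * ‖f s‖ ^ 2 = (‖w s‖ * ‖f s‖) ^ 2 := by rw [mul_pow, hwn]
    change w' s * ‖f s‖ ^ 2 + w s * (2 * inner ℝ (f s) (deriv f s)) ≤ _
    change (w' s + w s ^ 2 / 16) * ‖f s‖ ^ 2 ≤ _ at hk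
    nlinarith

/-- The Hardy inequality for a twisted strip, with constants kept abstract: `K` bounds the
weight from above and `m` bounds the transverse spectral gap from below on the interval. -/
theorem twisted_strip_hardy {a b s₀ K m c : ℝ} (ha : 0 < a) (hb : 0 < b) {σ : ℝ → ℝ}
    (hσ : Continuous σ) (hσ2 : ∀ s, a ^ 2 * σ s ^ 2 ≤ 2) (hK0 : 0 < K)
    (hK : ∀ s, ∀ t ∈ Ioo (-a) a, Real.sqrt (1 + t ^ 2 * σ s ^ 2) ≤ K)
    (hm0 : 0 ≤ m)
    (hm : ∀ s ∈ Icc (s₀ - b) (s₀ + b),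
      π ^ 2 / (2 * a) ^ 2 + m ≤ sInf (rayleighQuotients a (σ s)))
    (hc0 : 0 ≤ c) (hc1 : 16 * (c * K) ≤ K⁻¹) (hc2 : c * K * (2 + 64 / (2 * b) ^ 2) ≤ m)
    {ψ : ℝ → ℝ → ℂ} (hψ : ContDiff ℝ (⊤ : ℕ∞) (fun p : ℝ × ℝ => ψ p.1 p.2))
    (hψc : HasCompactSupport (fun p : ℝ × ℝ => ψ p.1 p.2))
    (hψs : tsupport (fun p : ℝ × ℝ => ψ p.1 p.2) ⊆ univ ×ˢ Ioo (-a) a) :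
    c * (∫ s : ℝ, ∫ t in Ioo (-a) a,
        (1 + (s - s₀) ^ 2)⁻¹ * ‖ψ s t‖ ^ 2 * Real.sqrt (1 + t ^ 2 * σ s ^ 2)) ≤
      ((∫ s : ℝ, ∫ t in Ioo (-a) a,
          (Real.sqrt (1 + t ^ 2 * σ s ^ 2))⁻¹ * ‖deriv (fun x => ψ x t) s‖ ^ 2) +
        (∫ s : ℝ, ∫ t in Ioo (-a) a,
          Real.sqrt (1 + t ^ 2 * σ s ^ 2) * ‖deriv (ψ s) t‖ ^ 2)) -
        (π ^ 2 / (2 * a) ^ 2) *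
          (∫ s : ℝ, ∫ t in Ioo (-a) a, ‖ψ s t‖ ^ 2 * Real.sqrt (1 + t ^ 2 * σ s ^ 2)) := by
  set Ψ : ℝ × ℝ → ℂ := fun p => ψ p.1 p.2 with hΨ
  set I := Icc (s₀ - b) (s₀ + b) with hI
  set ν : Measure ℝ := volume.restrict (Ioo (-a) a) with hν
  set E := π ^ 2 / (2 * a) ^ 2 with hE
  have hΨcont : Continuous fun p : ℝ × ℝ => ψ p.1 p.2 := hψ.continuous
  have hfd : Continuous (fderiv ℝ Ψ) := hψ.continuous_fderiv (by simp)
  have hdiff : ∀ p, HasFDerivAt Ψ (fderiv ℝ Ψ p) p := fun p =>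
    (hψ.differentiable (by simp)).differentiableAt.hasFDerivAt
  have hs : ∀ s t, deriv (fun x => ψ x t) s = fderiv ℝ Ψ (s, t) (1, 0) := fun s t =>
    ((hdiff (s, t)).comp_hasDerivAt (f := fun x => (x, t)) s
      ((hasDerivAt_id s).prodMk (hasDerivAt_const s t))).deriv
  have ht : ∀ s t, deriv (ψ s) t = fderiv ℝ Ψ (s, t) (0, 1) := fun s t =>
    ((hdiff (s, t)).comp_hasDerivAt (f := fun x => (s, x)) t
      ((hasDerivAt_const t s).prodMk (hasDerivAt_id t))).deriv
  have cs : Continuous fun p : ℝ × ℝ => deriv (fun x => ψ x p.2) p.1 := by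
    simp_rw [hs]
    exact hfd.clm_apply continuous_const
  have ct : Continuous fun p : ℝ × ℝ => deriv (ψ p.1) p.2 := by
    simp_rw [ht]
    exact hfd.clm_apply continuous_const
  have ks : HasCompactSupport fun p : ℝ × ℝ => ‖deriv (fun x => ψ x p.2) p.1‖ ^ 2 := by
    simp_rw [hs]
    exact (hψc.fderiv_apply ℝ (1, 0)).comp_left (g := fun z => ‖z‖ ^ 2) (by simp)
  have kt : HasCompactSupport fun p : ℝ × ℝ => ‖deriv (ψ p.1) p.2‖ ^ 2 := by
    simp_rw [ht]
    exact (hψc.fderiv_apply ℝ (0, 1)).comp_left (g := fun z => ‖z‖ ^ 2) (by simp)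
  have k0 : HasCompactSupport fun p : ℝ × ℝ => ‖ψ p.1 p.2‖ ^ 2 :=
    hψc.comp_left (g := fun z => ‖z‖ ^ 2) (by simp)
  have int_of : ∀ {g : ℝ × ℝ → ℝ}, Continuous g → HasCompactSupport g →
      Integrable g (volume.prod ν) := fun h1 h2 => h1.integrable_of_hasCompactSupport h2
  have hw0 : ∀ p : ℝ × ℝ, Real.sqrt (1 + p.2 ^ 2 * σ p.1 ^ 2) ≠ 0 := fun p =>
    (Real.sqrt_pos.2 (by positivity)).ne'
  have hρ0 : ∀ p : ℝ × ℝ, 1 + (p.1 - s₀) ^ 2 ≠ 0 := fun p => by positivity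
  have cn : Continuous fun p : ℝ × ℝ => ‖ψ p.1 p.2‖ ^ 2 := hΨcont.norm.pow 2
  have cns : Continuous fun p : ℝ × ℝ => ‖deriv (fun x => ψ x p.2) p.1‖ ^ 2 := cs.norm.pow 2
  have cnt : Continuous fun p : ℝ × ℝ => ‖deriv (ψ p.1) p.2‖ ^ 2 := ct.norm.pow 2
  have ch : Continuous fun p : ℝ × ℝ => Real.sqrt (1 + p.2 ^ 2 * σ p.1 ^ 2) :=
    (continuous_const.add ((continuous_snd.pow 2).mul ((hσ.comp continuous_fst).pow 2))).sqrt
  have cρ : Continuous fun p : ℝ × ℝ => (1 + (p.1 - s₀) ^ 2)⁻¹ :=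
    Continuous.inv₀ (by fun_prop) hρ0
  have cw : Continuous fun p : ℝ × ℝ => (Real.sqrt (1 + p.2 ^ 2 * σ p.1 ^ 2))⁻¹ :=
    ch.inv₀ hw0
  have iP : Integrable (fun p : ℝ × ℝ => (Real.sqrt (1 + p.2 ^ 2 * σ p.1 ^ 2))⁻¹ *
      ‖deriv (fun x => ψ x p.2) p.1‖ ^ 2) (volume.prod ν) :=
    int_of (cw.mul cns) ks.mul_left
  have iQ : Integrable (fun p : ℝ × ℝ => Real.sqrt (1 + p.2 ^ 2 * σ p.1 ^ 2) *
      ‖deriv (ψ p.1) p.2‖ ^ 2) (volume.prod ν) :=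
    int_of (ch.mul cnt) kt.mul_left
  have iR : Integrable (fun p : ℝ × ℝ => ‖ψ p.1 p.2‖ ^ 2 *
      Real.sqrt (1 + p.2 ^ 2 * σ p.1 ^ 2)) (volume.prod ν) :=
    int_of (cn.mul ch) k0.mul_right
  have iS : Integrable (fun p : ℝ × ℝ => (1 + (p.1 - s₀) ^ 2)⁻¹ * ‖ψ p.1 p.2‖ ^ 2 *
      Real.sqrt (1 + p.2 ^ 2 * σ p.1 ^ 2)) (volume.prod ν) :=
    int_of ((cρ.mul cn).mul ch) k0.mul_left.mul_right
  have iD : Integrable (fun p : ℝ × ℝ => ‖deriv (fun x => ψ x p.2) p.1‖ ^ 2)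
      (volume.prod ν) := int_of cns ks
  have iT : Integrable (fun p : ℝ × ℝ => (1 + (p.1 - s₀) ^ 2)⁻¹ * ‖ψ p.1 p.2‖ ^ 2)
      (volume.prod ν) := int_of (cρ.mul cn) k0.mul_left
  have iJ : ∀ C : ℝ, Integrable (fun p : ℝ × ℝ => I.indicator (fun _ => C) p.1 *
      ‖ψ p.1 p.2‖ ^ 2) (volume.prod ν) := by
    intro C
    have : (fun p : ℝ × ℝ => I.indicator (fun _ => C) p.1 * ‖ψ p.1 p.2‖ ^ 2) =
        (Prod.fst ⁻¹' I).indicator fun p : ℝ × ℝ => C * ‖ψ p.1 p.2‖ ^ 2 := by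
      funext p
      by_cases hp : p.1 ∈ I <;> simp [hp]
    rw [this]
    exact (int_of (cn.const_mul C) k0.mul_left).indicator (measurable_fst measurableSet_Icc)
  have iG : Integrable (fun p : ℝ × ℝ => Real.sqrt (1 + p.2 ^ 2 * σ p.1 ^ 2) *
      ‖deriv (ψ p.1) p.2‖ ^ 2 - E * (‖ψ p.1 p.2‖ ^ 2 *
        Real.sqrt (1 + p.2 ^ 2 * σ p.1 ^ 2))) (volume.prod ν) := iQ.sub (iR.const_mul E)
  have iPJ : Integrable (fun p : ℝ × ℝ => (Real.sqrt (1 + p.2 ^ 2 * σ p.1 ^ 2))⁻¹ *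
      ‖deriv (fun x => ψ x p.2) p.1‖ ^ 2 + I.indicator (fun _ => m) p.1 * ‖ψ p.1 p.2‖ ^ 2)
      (volume.prod ν) := iP.add (iJ m)
  have iH : Integrable (fun p : ℝ × ℝ => (16 * ‖deriv (fun x => ψ x p.2) p.1‖ ^ 2 +
      I.indicator (fun _ => 2 + 64 / (2 * b) ^ 2) p.1 * ‖ψ p.1 p.2‖ ^ 2) -
        (1 + (p.1 - s₀) ^ 2)⁻¹ * ‖ψ p.1 p.2‖ ^ 2) (volume.prod ν) :=
    ((iD.const_mul 16).add (iJ _)).sub iT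
  have transverse : ∫ p, I.indicator (fun _ => m) p.1 * ‖ψ p.1 p.2‖ ^ 2 ∂(volume.prod ν) ≤
      (∫ p, Real.sqrt (1 + p.2 ^ 2 * σ p.1 ^ 2) * ‖deriv (ψ p.1) p.2‖ ^ 2 ∂(volume.prod ν)) -
        E * ∫ p, ‖ψ p.1 p.2‖ ^ 2 * Real.sqrt (1 + p.2 ^ 2 * σ p.1 ^ 2) ∂(volume.prod ν) := by
    rw [← integral_const_mul, ← integral_sub iQ (iR.const_mul E), integral_prod _ (iJ m),
      integral_prod _ iG]
    refine integral_mono (iJ m).integral_prod_left iG.integral_prod_left fun s => ?_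
    have hf : ContDiff ℝ (⊤ : ℕ∞) (ψ s) := hψ.comp (contDiff_const.prodMk contDiff_id)
    have hfs : tsupport (ψ s) ⊆ Ioo (-a) a := by
      have h1 : tsupport (ψ s) ⊆ (fun t => (s, t)) ⁻¹' tsupport Ψ :=
        closure_minimal (fun t ht => subset_tsupport Ψ ht)
          ((isClosed_tsupport Ψ).preimage (by fun_prop))
      exact fun t ht => (hψs (h1 ht)).2
    have hfk : HasCompactSupport (ψ s) :=
      Metric.isCompact_of_isClosed_isBounded (isClosed_tsupport _)
        (Metric.isBounded_Ioo (-a) a |>.subset hfs)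
    have hfc := hf.continuous
    have hfd : Continuous (deriv (ψ s)) := hf.continuous_deriv (by simp)
    have i1 : Integrable (fun t => Real.sqrt (1 + t ^ 2 * σ s ^ 2) * ‖deriv (ψ s) t‖ ^ 2) ν :=
      Continuous.integrableOn_Ioo_real ((continuous_sqrt_weight _).mul (hfd.norm.pow 2)) _ _
    have i2 : Integrable (fun t => ‖ψ s t‖ ^ 2 * Real.sqrt (1 + t ^ 2 * σ s ^ 2)) ν :=
      Continuous.integrableOn_Ioo_real ((hfc.norm.pow 2).mul (continuous_sqrt_weight _)) _ _
    have i3 : Integrable (fun t => ‖ψ s t‖ ^ 2) ν :=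
      Continuous.integrableOn_Ioo_real (hfc.norm.pow 2) _ _
    simp only
    rw [integral_sub i1 (i2.const_mul E), integral_const_mul, integral_const_mul]
    by_cases hsI : s ∈ I
    · rw [indicator_of_mem hsI]
      have h1 := weighted_inequality_complex (a := a) (q := σ s)
        (fun φ h1 h2 h3 => sInf_rayleighQuotients_mul_le a (σ s) h1 h2 h3) hf hfk hfs
      have h2 : ∫ t, ‖ψ s t‖ ^ 2 ∂ν ≤
          ∫ t, ‖ψ s t‖ ^ 2 * Real.sqrt (1 + t ^ 2 * σ s ^ 2) ∂ν := by
        refine integral_mono i3 i2 fun t => ?_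
        refine le_mul_of_one_le_right (by positivity) ?_
        rw [Real.one_le_sqrt]
        nlinarith [mul_nonneg (sq_nonneg t) (sq_nonneg (σ s))]
      have h3 : 0 ≤ ∫ t, ‖ψ s t‖ ^ 2 * Real.sqrt (1 + t ^ 2 * σ s ^ 2) ∂ν :=
        integral_nonneg fun t => by positivity
      have h4 := mul_le_mul_of_nonneg_right (hm s hsI) h3
      have h5 := mul_le_mul_of_nonneg_left h2 hm0
      linarith
    · rw [indicator_of_notMem hsI]
      have h1 := weighted_inequality_complex (a := a) (q := σ s) (M := E)
        (fun φ h1 _ h3 => weighted_poincare ha (hσ2 s) h1 h3) hf hfk hfs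
      linarith
  have longitudinal : 0 ≤ ∫ p, ((16 * ‖deriv (fun x => ψ x p.2) p.1‖ ^ 2 +
      I.indicator (fun _ => 2 + 64 / (2 * b) ^ 2) p.1 * ‖ψ p.1 p.2‖ ^ 2) -
        (1 + (p.1 - s₀) ^ 2)⁻¹ * ‖ψ p.1 p.2‖ ^ 2) ∂(volume.prod ν) := by
    rw [integral_prod_symm _ iH]
    refine integral_nonneg fun t => ?_
    have hf : ContDiff ℝ 1 fun x => ψ x t :=
      (hψ.of_le (by simp)).comp (contDiff_id.prodMk contDiff_const)
    have hfk : HasCompactSupport fun x => ψ x t := by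
      refine HasCompactSupport.of_support_subset_isCompact (hψc.isCompact.image continuous_fst)
        fun x hx => ⟨(x, t), subset_tsupport _ hx, rfl⟩
    simpa only [Pi.zero_apply] using hardy_local hb s₀ hf hfk
  have pointwise : c * ∫ p, (1 + (p.1 - s₀) ^ 2)⁻¹ * ‖ψ p.1 p.2‖ ^ 2 *
        Real.sqrt (1 + p.2 ^ 2 * σ p.1 ^ 2) ∂(volume.prod ν) ≤
      (∫ p, (Real.sqrt (1 + p.2 ^ 2 * σ p.1 ^ 2))⁻¹ *
        ‖deriv (fun x => ψ x p.2) p.1‖ ^ 2 ∂(volume.prod ν)) +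
      (∫ p, I.indicator (fun _ => m) p.1 * ‖ψ p.1 p.2‖ ^ 2 ∂(volume.prod ν)) -
      c * K * ∫ p, ((16 * ‖deriv (fun x => ψ x p.2) p.1‖ ^ 2 +
      I.indicator (fun _ => 2 + 64 / (2 * b) ^ 2) p.1 * ‖ψ p.1 p.2‖ ^ 2) -
        (1 + (p.1 - s₀) ^ 2)⁻¹ * ‖ψ p.1 p.2‖ ^ 2) ∂(volume.prod ν) := by
    have iL := iH.const_mul (c * K)
    rw [← integral_const_mul, ← integral_const_mul, ← integral_add iP (iJ m),
      ← integral_sub iPJ iL]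
    refine integral_mono_ae (iS.const_mul c) (iPJ.sub iL) ?_
    have hmem : ∀ᵐ p ∂((volume : Measure ℝ).prod ν), p.2 ∈ Ioo (-a) a :=
      Measure.quasiMeasurePreserving_snd.ae (ae_restrict_mem measurableSet_Ioo)
    filter_upwards [hmem] with p hp
    have hh := hK p.1 p.2 hp
    have hpos : 0 < Real.sqrt (1 + p.2 ^ 2 * σ p.1 ^ 2) := Real.sqrt_pos.2 (by positivity)
    have hinv : K⁻¹ ≤ (Real.sqrt (1 + p.2 ^ 2 * σ p.1 ^ 2))⁻¹ := inv_anti₀ hpos hh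
    have hρ : 0 ≤ (1 + (p.1 - s₀) ^ 2)⁻¹ * ‖ψ p.1 p.2‖ ^ 2 := by positivity
    have h1 := mul_le_mul_of_nonneg_right (hc1.trans hinv)
      (sq_nonneg ‖deriv (fun x => ψ x p.2) p.1‖)
    have h2 : c * K * (I.indicator (fun _ => 2 + 64 / (2 * b) ^ 2) p.1 * ‖ψ p.1 p.2‖ ^ 2) ≤
        I.indicator (fun _ => m) p.1 * ‖ψ p.1 p.2‖ ^ 2 := by
      rw [← mul_assoc]
      refine mul_le_mul_of_nonneg_right ?_ (sq_nonneg _)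
      by_cases hpI : p.1 ∈ I
      · rwa [indicator_of_mem hpI, indicator_of_mem hpI]
      · rw [indicator_of_notMem hpI, indicator_of_notMem hpI, mul_zero]
    have h3 := mul_le_mul_of_nonneg_left (mul_le_mul_of_nonneg_left hh hρ) hc0
    linarith
  rw [integral_prod _ iS, integral_prod _ iP] at pointwise
  rw [integral_prod _ iQ, integral_prod _ iR] at transverse
  have := mul_nonneg (mul_nonneg hc0 hK0.le) longitudinal
  linarith

/-- **Hardy inequality with an explicit constant.** If `I = [s₀ - b, s₀ + b]`
is a closed bounded interval (of length `|I| = 2b > 0`) on which the function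
`λ` is strictly positive, then the Hardy inequality
`Q₀[ψ] - E₁‖ψ‖²_{H₀} ≥ c ‖ρ⁻¹ψ‖²_{H₀}` holds with the explicit constant
`c = min{ (min_I λ)/((2+64/|I|²)(1+a²‖σ‖_∞²)^{1/2}), 1/(16(1+a²‖σ‖_∞²)) } > 0`. -/
theorem hardy_inequality_explicit_constant
    (a : ℝ) (ha : 0 < a)
    (σ : ℝ → ℝ) (hσcont : Continuous σ) (hσbdd : ∃ M, ∀ s, |σ s| ≤ M)
    (hσne : ∃ s, σ s ≠ 0)
    (hthin : a * (⨆ s, |σ s|) < Real.sqrt 2)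
    (lam : ℝ → ℝ)
    (hlam : ∀ s, lam s =
      sInf {r : ℝ | ∃ φ : ℝ → ℝ, ContDiff ℝ (⊤ : ℕ∞) φ ∧ HasCompactSupport φ ∧
        tsupport φ ⊆ Ioo (-a) a ∧ φ ≠ 0 ∧
        r = (∫ t in Ioo (-a) a, (deriv φ t) ^ 2 * Real.sqrt (1 + t ^ 2 * σ s ^ 2)) /
            (∫ t in Ioo (-a) a, (φ t) ^ 2 * Real.sqrt (1 + t ^ 2 * σ s ^ 2))}
      - π ^ 2 / (2 * a) ^ 2)
    (s₀ b : ℝ) (hb : 0 < b)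
    (hIpos : ∀ s ∈ Icc (s₀ - b) (s₀ + b), 0 < lam s) :
    ∃ c : ℝ,
      c = min
        (sInf (lam '' Icc (s₀ - b) (s₀ + b)) /
          ((2 + 64 / (2 * b) ^ 2) * Real.sqrt (1 + a ^ 2 * (⨆ s, |σ s|) ^ 2)))
        (1 / (16 * (1 + a ^ 2 * (⨆ s, |σ s|) ^ 2))) ∧
      0 < c ∧
      ∀ ψ : ℝ → ℝ → ℂ,
        ContDiff ℝ (⊤ : ℕ∞) (fun p : ℝ × ℝ => ψ p.1 p.2) →
        HasCompactSupport (fun p : ℝ × ℝ => ψ p.1 p.2) →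
        tsupport (fun p : ℝ × ℝ => ψ p.1 p.2) ⊆ univ ×ˢ Ioo (-a) a →
        ((∫ s : ℝ, ∫ t in Ioo (-a) a,
              (Real.sqrt (1 + t ^ 2 * σ s ^ 2))⁻¹ *
                ‖deriv (fun x => ψ x t) s‖ ^ 2) +
            (∫ s : ℝ, ∫ t in Ioo (-a) a,
              Real.sqrt (1 + t ^ 2 * σ s ^ 2) * ‖deriv (ψ s) t‖ ^ 2)) -
            (π ^ 2 / (2 * a) ^ 2) *
              (∫ s : ℝ, ∫ t in Ioo (-a) a,
                ‖ψ s t‖ ^ 2 * Real.sqrt (1 + t ^ 2 * σ s ^ 2)) ≥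
          c * ∫ s : ℝ, ∫ t in Ioo (-a) a,
                (1 + (s - s₀) ^ 2)⁻¹ * ‖ψ s t‖ ^ 2 *
                  Real.sqrt (1 + t ^ 2 * σ s ^ 2) := by
  have hbdd : BddAbove (range fun s => |σ s|) := by
    obtain ⟨M, hM⟩ := hσbdd
    exact ⟨M, by rintro _ ⟨s, rfl⟩; exact hM s⟩
  have hle : ∀ s, |σ s| ≤ ⨆ s, |σ s| := le_ciSup hbdd
  set S := ⨆ s, |σ s| with hS
  have hS0 : 0 ≤ S := (abs_nonneg _).trans (hle 0)
  have hσS : ∀ s, σ s ^ 2 ≤ S ^ 2 := fun s => by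
    rw [← sq_abs]
    exact pow_le_pow_left₀ (abs_nonneg _) (hle s) 2
  have haS : a ^ 2 * S ^ 2 ≤ 2 := by
    rw [← mul_pow, ← Real.sq_sqrt (show (0 : ℝ) ≤ 2 by norm_num)]
    exact pow_le_pow_left₀ (by positivity) hthin.le 2
  have hlam' : ∀ s, lam s = sInf (rayleighQuotients a (σ s)) - π ^ 2 / (2 * a) ^ 2 := hlam
  have hcont : Continuous lam := by
    rw [funext hlam']
    exact ((continuous_sInf_rayleighQuotients a).comp hσcont).sub continuous_const
  have hne : (Icc (s₀ - b) (s₀ + b)).Nonempty := nonempty_Icc.2 (by linarith)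
  obtain ⟨x, hx, hmin⟩ := isCompact_Icc.exists_sInf_image_eq hne hcont.continuousOn
  have hmpos : 0 < sInf (lam '' Icc (s₀ - b) (s₀ + b)) := hmin ▸ hIpos x hx
  have hm : ∀ s ∈ Icc (s₀ - b) (s₀ + b),
      π ^ 2 / (2 * a) ^ 2 + sInf (lam '' Icc (s₀ - b) (s₀ + b)) ≤
        sInf (rayleighQuotients a (σ s)) := by
    intro s hs
    have := csInf_le (isCompact_Icc.image hcont).bddBelow (mem_image_of_mem lam hs)
    linarith [hlam' s]
  set m := sInf (lam '' Icc (s₀ - b) (s₀ + b))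
  have hKsq : Real.sqrt (1 + a ^ 2 * S ^ 2) ^ 2 = 1 + a ^ 2 * S ^ 2 :=
    Real.sq_sqrt (by positivity)
  have hK0 : 0 < Real.sqrt (1 + a ^ 2 * S ^ 2) := Real.sqrt_pos.2 (by positivity)
  have hC0 : 0 < 2 + 64 / (2 * b) ^ 2 := by positivity
  have hc0 : 0 < min (m / ((2 + 64 / (2 * b) ^ 2) * Real.sqrt (1 + a ^ 2 * S ^ 2)))
      (1 / (16 * (1 + a ^ 2 * S ^ 2))) := lt_min (by positivity) (by positivity)
  refine ⟨_, rfl, hc0, fun ψ h1 h2 h3 => ?_⟩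
  refine twisted_strip_hardy ha hb hσcont (fun s => ?_) hK0 (fun s t ht => ?_) hmpos.le hm
    hc0.le ?_ ?_ h1 h2 h3
  · exact (mul_le_mul_of_nonneg_left (hσS s) (sq_nonneg a)).trans haS
  · apply Real.sqrt_le_sqrt
    have : t ^ 2 ≤ a ^ 2 := by nlinarith [ht.1, ht.2]
    have := mul_le_mul this (hσS s) (sq_nonneg _) (sq_nonneg _)
    linarith
  · have h := min_le_right (m / ((2 + 64 / (2 * b) ^ 2) * Real.sqrt (1 + a ^ 2 * S ^ 2)))
      (1 / (16 * (1 + a ^ 2 * S ^ 2)))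
    rw [← hKsq, le_div_iff₀ (by positivity), hKsq] at h
    rw [inv_eq_one_div, le_div_iff₀ hK0]
    nlinarith
  · have h := min_le_left (m / ((2 + 64 / (2 * b) ^ 2) * Real.sqrt (1 + a ^ 2 * S ^ 2)))
      (1 / (16 * (1 + a ^ 2 * S ^ 2)))
    rw [le_div_iff₀ (by positivity)] at h
    linarith
end

section
/- Let a > 0 and let σ, k : ℝ → ℝ be bounded continuous functions. Assume σ is not identically zero, a·‖σ‖_∞ < √2, and there exists ε₀ ∈ [0, a^{-1}) such that |k(s)| ≤ ε₀/(1 + s²) for all s ∈ ℝ. Then there exists a constant C > 0 (depending only on a, σ and the choices made in the Hardy inequality for the geodesic strip) such that if ε₀ ≤ C, then for every ψ ∈ C_c^∞(ℝ × (−a,a)): ∫_{ℝ×(−a,a)} h(s,t)^{-1} |∂_s ψ|² ds dt + ∫_{ℝ×(−a,a)} h(s,t) |∂_t ψ|² ds dt ≥ E₁ · ∫_{ℝ×(−a,a)} |ψ|² h(s,t) ds dt; i.e. the Dirichlet Laplacian of the mildly curved ruled strip is bounded below by E₁ in the sense of quadratic forms. -/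
open MeasureTheory Real Set

/-- If `P` solves the Riccati inequality `P² ≤ A (P' + q)`, then the form `∫ A |f'|² + q |f|²` is
nonnegative on functions vanishing at the end points. -/
lemma intervalIntegral_nonneg_of_riccati {f f' : ℝ → ℂ} {A q P P' : ℝ → ℝ} {b : ℝ} (hb : 0 ≤ b)
    (hf : ∀ x, HasDerivAt f (f' x) x) (hfb : f b = 0) (hfb' : f (-b) = 0)
    (hP : ∀ x ∈ Icc (-b) b, HasDerivAt P (P' x) x) (hA : ∀ x ∈ Icc (-b) b, 0 < A x)
    (hR : ∀ x ∈ Icc (-b) b, P x ^ 2 ≤ A x * (P' x + q x))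
    (hint : IntegrableOn (fun x => A x * ‖f' x‖ ^ 2 + q x * ‖f x‖ ^ 2) (Icc (-b) b)) :
    0 ≤ ∫ x in -b..b, (A x * ‖f' x‖ ^ 2 + q x * ‖f x‖ ^ 2) := by
  have hd : ∀ x ∈ Icc (-b) b, HasDerivAt (fun x => -(P x * ‖f x‖ ^ 2))
      (-(P' x * ‖f x‖ ^ 2 + P x * (2 * inner ℝ (f x) (f' x)))) x := fun x hx =>
    ((hP x hx).mul (hf x).norm_sq).neg
  have key := intervalIntegral.sub_le_integral_of_hasDeriv_right_of_le (by linarith : -b ≤ b)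
    (fun x hx => (hd x hx).continuousAt.continuousWithinAt)
    (fun x hx => (hd x (Ioo_subset_Icc_self hx)).hasDerivWithinAt) hint
    (fun x hx => by
      have hx' := Ioo_subset_Icc_self hx
      have h1 := hA x hx'
      have h2 := hR x hx'
      have h3 : |P x * inner ℝ (f x) (f' x)| ≤ |P x| * (‖f x‖ * ‖f' x‖) := by
        rw [abs_mul]
        exact mul_le_mul_of_nonneg_left (abs_real_inner_le_norm _ _) (abs_nonneg _)
      have h4 := neg_le_of_abs_le h3
      have h5 : 0 ≤ A x * (A x * ‖f' x‖ ^ 2 - 2 * (|P x| * (‖f x‖ * ‖f' x‖))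
          + (P' x + q x) * ‖f x‖ ^ 2) := by
        have := mul_le_mul_of_nonneg_right h2 (sq_nonneg ‖f x‖)
        rw [← sq_abs] at this
        nlinarith [sq_nonneg (A x * ‖f' x‖ - |P x| * ‖f x‖)]
      have h6 := nonneg_of_mul_nonneg_right h5 h1
      linarith)
  simpa [hfb, hfb'] using key

/-- A Riccati certificate for the one-dimensional Hardy inequality
`∫ c₁ |f'|² + c₂ σ² |f|² ≥ K ∫ |f|² / (1 + x²)²`. -/
lemma exists_hardy_riccati {σ : ℝ → ℝ} (hσ : Continuous σ) (hne : ∃ s, σ s ≠ 0) {c₁ c₂ : ℝ}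
    (hc₁ : 0 < c₁) (hc₂ : 0 < c₂) :
    ∃ K > 0, ∃ P P' : ℝ → ℝ, (∀ x, HasDerivAt P (P' x) x) ∧
      ∀ x, P x ^ 2 ≤ c₁ * (P' x + (c₂ * σ x ^ 2 - K / (1 + x ^ 2) ^ 2)) := by
  obtain ⟨s₀, hs₀⟩ := hne
  set R : ℝ := |s₀| + 1 with hR
  have hRpos : 0 < R := by positivity
  set ρ : ℝ → ℝ := fun s => σ s ^ 2 * max 0 (R - |s|) with hρ
  have hρc : Continuous ρ := by fun_prop
  have hρ0 : ∀ s, 0 ≤ ρ s := fun s => by positivity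
  have hρz : ∀ s, R ≤ |s| → ρ s = 0 := fun s hs => by
    simp [hρ, max_eq_left (sub_nonpos.2 hs)]
  have hρle : ∀ s, ρ s ≤ R * σ s ^ 2 := fun s => by
    have : max 0 (R - |s|) ≤ R := max_le hRpos.le (by linarith [abs_nonneg s])
    simp only [hρ]
    nlinarith [sq_nonneg (σ s)]
  have hint : ∀ u v, IntervalIntegrable ρ volume u v := fun u v => hρc.intervalIntegrable u v
  set Z : ℝ := ∫ x in -R..R, ρ x with hZ
  have hZpos : 0 < Z := by
    refine intervalIntegral.integral_pos (by linarith) hρc.continuousOn (fun x _ => hρ0 x)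
      ⟨s₀, ⟨by linarith [neg_abs_le s₀], by linarith [le_abs_self s₀]⟩, ?_⟩
    have : max 0 (R - |s₀|) = 1 := by rw [hR]; simp
    simp only [hρ, this]
    positivity
  set G : ℝ → ℝ := fun s => (∫ x in -R..s, ρ x) / Z with hG
  have hGd : ∀ s, HasDerivAt G (ρ s / Z) s := fun s =>
    (intervalIntegral.integral_hasDerivAt_right (hint _ _)
      (hρc.stronglyMeasurableAtFilter _ _) hρc.continuousAt).div_const Z
  have hGl : ∀ s ≤ -R, G s = 0 := fun s hs => by
    have : ∫ x in -R..s, ρ x = 0 := by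
      refine intervalIntegral.integral_zero_ae (ae_of_all _ fun x hx => hρz x ?_)
      rw [uIoc_of_ge hs] at hx
      exact le_abs.2 (Or.inr (by linarith [hx.2]))
    simp [hG, this]
  have hGr : ∀ s, R ≤ s → G s = 1 := fun s hs => by
    have : ∫ x in R..s, ρ x = 0 := by
      refine intervalIntegral.integral_zero_ae (ae_of_all _ fun x hx => hρz x ?_)
      rw [uIoc_of_le hs] at hx
      exact le_abs.2 (Or.inl hx.1.le)
    simp only [hG]
    rw [← intervalIntegral.integral_add_adjacent_intervals (hint (-R) R) (hint R s), this, add_zero,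
      div_self hZpos.ne']
  have hGmono : Monotone G := monotone_of_deriv_nonneg (fun s => (hGd s).differentiableAt)
    fun s => by rw [(hGd s).deriv]; exact div_nonneg (hρ0 s) hZpos.le
  have hG0 : ∀ s, 0 ≤ G s := fun s => by
    rw [← hGl _ (min_le_right s (-R))]; exact hGmono (min_le_left _ _)
  have hG1 : ∀ s, G s ≤ 1 := fun s => by
    rw [← hGr _ (le_max_right s R)]; exact hGmono (le_max_left _ _)
  set j : ℝ → ℝ := fun s => √(1 + s ^ 2) with hj
  have hj1 : ∀ s, 1 ≤ j s := fun s => by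
    rw [hj]; exact one_le_sqrt.2 (by nlinarith [sq_nonneg s])
  have hjsq : ∀ s, j s ^ 2 = 1 + s ^ 2 := fun s => sq_sqrt (by positivity)
  have hjabs : ∀ s, |s| ≤ j s := fun s => abs_le_sqrt (by linarith)
  have hjd : ∀ s, HasDerivAt j (s / j s) s := fun s => by
    have h1 : HasDerivAt (fun s : ℝ => 1 + s ^ 2) (2 * s) s := by
      simpa using (hasDerivAt_pow 2 s).const_add 1
    have := h1.sqrt (by positivity)
    convert this using 1
    rw [mul_div_mul_left _ _ two_ne_zero]
  set D : ℝ → ℝ := fun s => 1 + s / j s - 2 * G s with hD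
  have hDd : ∀ s, HasDerivAt D (1 / j s ^ 3 - 2 * (ρ s / Z)) s := fun s => by
    have hjs := hj1 s
    have h1 := (((hasDerivAt_id s).div (hjd s) (by linarith)).const_add 1).sub ((hGd s).const_mul 2)
    refine h1.congr_deriv ?_
    have := hjsq s
    simp only [id]
    field_simp
    linear_combination Z * this
  have hsj : ∀ s, |s / j s| ≤ 1 := fun s => by
    rw [abs_div, abs_of_pos (by linarith [hj1 s] : 0 < j s)]
    exact div_le_one_of_le₀ (hjabs s) (by linarith [hj1 s])
  have htail : ∀ s, 1 - |s| / j s ≤ 1 / j s ^ 2 := fun s => by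
    have hjs := hj1 s
    rw [show 1 - |s| / j s = (j s - |s|) / j s by field_simp,
      div_le_div_iff₀ (by linarith) (by positivity)]
    have : (j s - |s|) * (j s + |s|) = 1 := by nlinarith [hjsq s, sq_abs s]
    nlinarith [hjabs s, abs_nonneg s]
  set M : ℝ := 4 * (1 + R ^ 2) ^ 2 with hM
  have hM4 : 4 ≤ M := by rw [hM]; nlinarith [sq_nonneg R]
  have hDb : ∀ s, D s ^ 2 ≤ M / (1 + s ^ 2) ^ 2 := fun s => by
    have hpos : 0 < (1 + s ^ 2) ^ 2 := by positivity
    have hcase : R ≤ |s| → |D s| ≤ 1 / j s ^ 2 := fun hs => by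
      have ht := htail s
      have hs1 := hsj s
      rcases le_abs.1 hs with h | h
      · rw [abs_of_nonneg (by linarith : 0 ≤ s)] at ht
        simp only [hD, hGr s h]
        rw [abs_of_nonpos] <;> linarith [(abs_le.1 hs1).2]
      · rw [abs_of_nonpos (by linarith : s ≤ 0), neg_div] at ht
        simp only [hD, hGl s (by linarith)]
        rw [abs_of_nonneg] <;> linarith [(abs_le.1 hs1).1]
    rw [le_div_iff₀ hpos]
    rcases le_total R |s| with hs | hs
    · have h1 := hcase hs
      rw [hjsq, le_div_iff₀ (by positivity)] at h1
      rw [← sq_abs, ← mul_pow]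
      have : (|D s| * (1 + s ^ 2)) ^ 2 ≤ 1 := pow_le_one₀ (by positivity) h1
      linarith
    · have h1 := abs_le.1 (hsj s)
      have h2 : |D s| ≤ 2 := abs_le.2 ⟨by simp only [hD]; linarith [hG1 s],
        by simp only [hD]; linarith [hG0 s]⟩
      have h3 : D s ^ 2 ≤ 4 := by rw [← sq_abs]; nlinarith [abs_nonneg (D s)]
      have h4 : s ^ 2 ≤ R ^ 2 := by rw [← sq_abs]; exact pow_le_pow_left₀ (abs_nonneg _) hs 2
      exact mul_le_mul h3 (by gcongr) hpos.le (by norm_num)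
  set ε : ℝ := min (c₁ / (2 * M)) (c₂ * Z / (2 * R)) with hε
  have hMpos : 0 < M := by linarith
  have hεpos : 0 < ε := by positivity
  have hε1 : ε * M ≤ c₁ / 2 := by
    have := min_le_left (c₁ / (2 * M)) (c₂ * Z / (2 * R))
    rw [← hε, le_div_iff₀ (by positivity)] at this
    linarith
  have hε2 : ε * (2 * R) ≤ c₂ * Z := by
    have := min_le_right (c₁ / (2 * M)) (c₂ * Z / (2 * R))
    rwa [← hε, le_div_iff₀ (by positivity)] at this
  refine ⟨ε / 2, by positivity, fun s => ε * D s, _, fun s => (hDd s).const_mul ε, fun s => ?_⟩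
  have h1 : 1 / (1 + s ^ 2) ^ 2 ≤ 1 / j s ^ 3 := by
    rw [← hjsq, ← pow_mul]
    have := hj1 s
    exact one_div_le_one_div_of_le (by positivity) (pow_le_pow_right₀ this (by norm_num))
  have h2 : ε * (2 * (ρ s / Z)) ≤ c₂ * σ s ^ 2 := by
    rw [← mul_div_assoc, ← mul_div_assoc, div_le_iff₀ hZpos]
    nlinarith [mul_le_mul_of_nonneg_left (hρle s) hεpos.le,
      mul_le_mul_of_nonneg_right hε2 (sq_nonneg (σ s))]
  have h3 := hDb s
  rw [div_eq_mul_one_div] at h3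
  rw [div_eq_mul_one_div (ε / 2)]
  set w := 1 / (1 + s ^ 2) ^ 2
  have hw : 0 < w := by positivity
  calc (ε * D s) ^ 2 = ε ^ 2 * D s ^ 2 := by ring
    _ ≤ ε ^ 2 * (M * w) := by gcongr
    _ = ε * M * (ε * w) := by ring
    _ ≤ c₁ / 2 * (ε * w) := by gcongr
    _ = c₁ * (ε * w - ε / 2 * w) := by ring
    _ ≤ _ := by
      gcongr
      nlinarith [mul_le_mul_of_nonneg_left h1 hεpos.le]

/-- Two-sided bounds for the weight of the ruled strip. -/
lemma strip_weight_bounds {a k σ δ t : ℝ} (hσ : a ^ 2 * σ ^ 2 ≤ 2 - δ) (hk : 6 * (a * |k|) ≤ δ)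
    (ht : t ∈ Ioo (-a) a) :
    6 * |t * k| ≤ δ ∧ 1 / 2 ≤ √((1 - t * k) ^ 2 + t ^ 2 * σ ^ 2) ∧
      √((1 - t * k) ^ 2 + t ^ 2 * σ ^ 2) ≤ 5 / 2 := by
  have hta : |t| ≤ a := (abs_lt.2 ht).le
  have htk : 6 * |t * k| ≤ δ := by
    rw [abs_mul]
    nlinarith [mul_le_mul_of_nonneg_right hta (abs_nonneg k)]
  have hδ2 : δ ≤ 2 := by nlinarith [sq_nonneg (a * σ)]
  have h1 := abs_le.1 (by linarith : |t * k| ≤ 1 / 2)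
  have ht2 : t ^ 2 * σ ^ 2 ≤ a ^ 2 * σ ^ 2 := by
    rw [← sq_abs t]; gcongr
  refine ⟨htk, le_sqrt_of_sq_le ?_, sqrt_le_iff.2 ⟨by norm_num, ?_⟩⟩
  · nlinarith [sq_nonneg (t * σ)]
  · nlinarith [abs_nonneg (t * k)]

/-- A Riccati certificate for the transverse Dirichlet problem on `(-a, a)` with weight
`h = √((1 - t k)² + t² σ²)`. -/
lemma exists_transverse_riccati {a k σ δ : ℝ} (ha : 0 < a) (hσ : a ^ 2 * σ ^ 2 ≤ 2 - δ)
    (hk : 6 * (a * |k|) ≤ δ) :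
    ∃ P P' : ℝ → ℝ, ∀ t ∈ Ioo (-a) a, HasDerivAt P (P' t) t ∧
      P t ^ 2 ≤ √((1 - t * k) ^ 2 + t ^ 2 * σ ^ 2) * (P' t +
        (-(π ^ 2 / (2 * a) ^ 2 * √((1 - t * k) ^ 2 + t ^ 2 * σ ^ 2)) -
          (δ / 125 * σ ^ 2 - 9 / 2 * k ^ 2))) := by
  set c : ℝ := π / (2 * a) with hc
  set h : ℝ → ℝ := fun t => √((1 - t * k) ^ 2 + t ^ 2 * σ ^ 2) with hh
  set N : ℝ → ℝ := fun t => t * σ ^ 2 - k * (1 - t * k) with hN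
  set T : ℝ → ℝ := fun t => c * tan (c * t) with hT
  refine ⟨fun t => T t * h t + N t / (2 * h t), fun t => (c ^ 2 + T t ^ 2) * h t + T t * (N t / h t)
    + ((σ ^ 2 + k ^ 2) / (2 * h t) - N t ^ 2 / (2 * h t ^ 3)), fun t ht => ?_⟩
  obtain ⟨htk, hh1, hh2⟩ := strip_weight_bounds (t := t) hσ hk ht
  change 1 / 2 ≤ h t at hh1
  change h t ≤ 5 / 2 at hh2
  have hpos : 0 < h t := by linarith
  have hsq : h t ^ 2 = (1 - t * k) ^ 2 + t ^ 2 * σ ^ 2 := sq_sqrt (by positivity)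
  have hNd : HasDerivAt N (σ ^ 2 + k ^ 2) t := by
    have h1 := ((hasDerivAt_id t).mul_const (σ ^ 2)).sub
      ((((hasDerivAt_id t).mul_const k).const_sub 1).const_mul k)
    refine h1.congr_deriv ?_
    ring
  have hhd : HasDerivAt h (N t / h t) t := by
    have h1 := ((((hasDerivAt_id t).mul_const k).const_sub 1).pow 2).add
      (((hasDerivAt_id t).pow 2).mul_const (σ ^ 2))
    have h2 := h1.sqrt (by simpa using (hsq ▸ by positivity : (1 - t * k) ^ 2 + t ^ 2 * σ ^ 2 ≠ 0))
    refine h2.congr_deriv ?_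
    rw [← mul_div_mul_left (N t) _ (two_ne_zero' ℝ)]
    simp only [hN, hh, Pi.add_apply, Pi.pow_apply, id]
    congr 1
    push_cast
    ring
  have hTd : HasDerivAt T (c ^ 2 + T t ^ 2) t := by
    have hcos : cos (c * t) ≠ 0 := by
      refine (cos_pos_of_mem_Ioo ⟨?_, ?_⟩).ne' <;> rw [hc, div_mul_eq_mul_div]
      · rw [lt_div_iff₀ (by positivity)]; nlinarith [pi_pos, ht.1]
      · rw [div_lt_iff₀ (by positivity)]; nlinarith [pi_pos, ht.2]
    have h1 := ((hasDerivAt_tan hcos).comp t ((hasDerivAt_id t).const_mul c)).const_mul c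
    refine h1.congr_deriv ?_
    have h2 := inv_one_add_tan_sq hcos
    rw [one_div, ← h2, inv_inv]
    ring
  refine ⟨?_, ?_⟩
  · have h1 := (hTd.mul hhd).add (hNd.div (hhd.const_mul 2) (by positivity))
    refine h1.congr_deriv ?_
    field_simp
  · have hlag : N t ^ 2 + σ ^ 2 = (σ ^ 2 + k ^ 2) * h t ^ 2 := by rw [hsq]; ring
    have ht2 : t ^ 2 * σ ^ 2 ≤ 2 - δ := le_trans (mul_le_mul_of_nonneg_right
      (sq_le_sq' ht.1.le ht.2.le) (sq_nonneg σ)) hσ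
    have hδ : 0 ≤ δ := le_trans (by positivity) hk
    have hδ2 : δ ≤ 2 := by nlinarith [sq_nonneg (t * σ)]
    have h1 := abs_le.1 (by linarith : |t * k| ≤ δ / 6)
    have hN2 : 2 * σ ^ 2 - N t ^ 2 ≥ δ / 2 * σ ^ 2 - 9 / 4 * k ^ 2 := by
      have e : 2 * σ ^ 2 - N t ^ 2 = σ ^ 2 * (2 - t ^ 2 * σ ^ 2 + 2 * (t * k) * (1 - t * k))
        - k ^ 2 * (1 - t * k) ^ 2 := by ring
      have e1 : δ / 2 ≤ 2 - t ^ 2 * σ ^ 2 + 2 * (t * k) * (1 - t * k) := by nlinarith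
      have e2 : (1 - t * k) ^ 2 ≤ 9 / 4 := by nlinarith
      rw [e]
      nlinarith [mul_le_mul_of_nonneg_left e1 (sq_nonneg σ),
        mul_le_mul_of_nonneg_left e2 (sq_nonneg k)]
    have h3u : h t ^ 3 ≤ 125 / 8 := by
      have := pow_le_pow_left₀ hpos.le hh2 3
      linarith
    have h3l : 1 / 8 ≤ h t ^ 3 := by
      have := pow_le_pow_left₀ (by norm_num) hh1 3
      linarith
    have hU : (δ / 125 * σ ^ 2 - 9 / 2 * k ^ 2) * h t ^ 3 ≤ (2 * σ ^ 2 - N t ^ 2) / 4 := by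
      nlinarith [mul_le_mul_of_nonneg_left h3u (by positivity : 0 ≤ δ / 125 * σ ^ 2),
        mul_le_mul_of_nonneg_left h3l (sq_nonneg k)]
    have hcc : π ^ 2 / (2 * a) ^ 2 = c ^ 2 := by rw [hc, div_pow]
    change (T t * h t + N t / (2 * h t)) ^ 2 ≤ h t * ((c ^ 2 + T t ^ 2) * h t + T t * (N t / h t)
      + ((σ ^ 2 + k ^ 2) / (2 * h t) - N t ^ 2 / (2 * h t ^ 3)) +
      (-(π ^ 2 / (2 * a) ^ 2 * h t) - (δ / 125 * σ ^ 2 - 9 / 2 * k ^ 2)))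
    rw [hcc, ← sub_nonneg]
    set U := δ / 125 * σ ^ 2 - 9 / 2 * k ^ 2
    have key : h t * ((c ^ 2 + T t ^ 2) * h t + T t * (N t / h t)
        + ((σ ^ 2 + k ^ 2) / (2 * h t) - N t ^ 2 / (2 * h t ^ 3)) + (-(c ^ 2 * h t) - U))
        - (T t * h t + N t / (2 * h t)) ^ 2
        = ((2 * σ ^ 2 - N t ^ 2) / 4 - U * h t ^ 3) / h t ^ 2 := by
      field_simp
      linear_combination -8 * hlag
    rw [key]
    exact div_nonneg (by linarith) (by positivity)

/-- **Theorem (stability of the spectrum for mildly curved strips).** Let `σ`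
be bounded, continuous, not identically zero, with `a ‖σ‖_∞ < √2`. Then there
is `C > 0`, depending only on `a` and `σ`, such that whenever
`ε₀ ∈ [0, a⁻¹)` with `ε₀ ≤ C` and `k` is a continuous function satisfying
`|k(s)| ≤ ε₀/(1+s²)` for all `s`, the quadratic form of the Dirichlet Laplacian
of the ruled strip with metric coefficient `h(s,t) = √((1-tk(s))² + t²σ(s)²)`
is bounded below by `E₁ = π²/(2a)²`, i.e. `Q[ψ] ≥ E₁ ‖ψ‖²_H` for every test
function `ψ ∈ C_c^∞(ℝ × (-a,a))`. -/
theorem stability_mildly_curved_strip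
    (a : ℝ) (ha : 0 < a)
    (σ : ℝ → ℝ) (hσcont : Continuous σ) (hσbdd : ∃ M, ∀ s, |σ s| ≤ M)
    (hσne : ∃ s, σ s ≠ 0)
    (hthin : a * (⨆ s, |σ s|) < Real.sqrt 2) :
    ∃ C > (0:ℝ), ∀ ε₀ : ℝ, 0 ≤ ε₀ → ε₀ < a⁻¹ → ε₀ ≤ C →
      ∀ k : ℝ → ℝ, Continuous k → (∀ s, |k s| ≤ ε₀ / (1 + s ^ 2)) →
      ∀ ψ : ℝ → ℝ → ℂ,
        ContDiff ℝ (⊤ : ℕ∞) (fun p : ℝ × ℝ => ψ p.1 p.2) →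
        HasCompactSupport (fun p : ℝ × ℝ => ψ p.1 p.2) →
        tsupport (fun p : ℝ × ℝ => ψ p.1 p.2) ⊆ univ ×ˢ Ioo (-a) a →
        (∫ s : ℝ, ∫ t in Ioo (-a) a,
              (Real.sqrt ((1 - t * k s) ^ 2 + t ^ 2 * σ s ^ 2))⁻¹ *
                ‖deriv (fun x => ψ x t) s‖ ^ 2) +
            (∫ s : ℝ, ∫ t in Ioo (-a) a,
              Real.sqrt ((1 - t * k s) ^ 2 + t ^ 2 * σ s ^ 2) *
                ‖deriv (ψ s) t‖ ^ 2) ≥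
          (π ^ 2 / (2 * a) ^ 2) *
            (∫ s : ℝ, ∫ t in Ioo (-a) a,
              ‖ψ s t‖ ^ 2 * Real.sqrt ((1 - t * k s) ^ 2 + t ^ 2 * σ s ^ 2)) := by
  obtain ⟨M, hM⟩ := hσbdd
  set S : ℝ := ⨆ s, |σ s| with hS
  have hσS : ∀ s, |σ s| ≤ S := le_ciSup (f := fun s => |σ s|) ⟨M, by rintro _ ⟨s, rfl⟩; exact hM s⟩
  have hS0 : 0 ≤ S := (abs_nonneg _).trans (hσS 0)
  set δ : ℝ := 2 - a ^ 2 * S ^ 2 with hδdef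
  have hδ : 0 < δ := by
    have := pow_lt_pow_left₀ hthin (by positivity) two_ne_zero
    rw [sq_sqrt (by norm_num), mul_pow] at this
    linarith
  have hσδ : ∀ s, a ^ 2 * σ s ^ 2 ≤ 2 - δ := fun s => by
    rw [hδdef, sub_sub_cancel, ← sq_abs (σ s)]
    have := hσS s
    gcongr
  obtain ⟨K, hK, P, P', hPd, hPR⟩ := exists_hardy_riccati hσcont hσne
    (by norm_num : (0 : ℝ) < 2 / 5) (by positivity : 0 < δ / 125)
  refine ⟨min 1 (min (2 * K / 9) (δ / (6 * a))), by positivity, ?_⟩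
  intro ε₀ hε₀ _ hεC k hkc hk ψ hψ hψc hψs
  simp only [le_min_iff] at hεC
  obtain ⟨hε1, hεK, hεδ⟩ := hεC
  have hkδ : ∀ s, 6 * (a * |k s|) ≤ δ := fun s => by
    have h1 : |k s| ≤ ε₀ := (hk s).trans (div_le_self hε₀ (by nlinarith [sq_nonneg s]))
    rw [le_div_iff₀ (by positivity)] at hεδ
    nlinarith
  have hkK : ∀ s, 9 / 2 * k s ^ 2 ≤ K / (1 + s ^ 2) ^ 2 := fun s => by
    have h1 : k s ^ 2 ≤ (ε₀ / (1 + s ^ 2)) ^ 2 := by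
      rw [← sq_abs]; exact pow_le_pow_left₀ (abs_nonneg _) (hk s) 2
    have h2 : 9 / 2 * ε₀ ^ 2 ≤ K := by nlinarith
    calc 9 / 2 * k s ^ 2 ≤ 9 / 2 * (ε₀ / (1 + s ^ 2)) ^ 2 := by gcongr
      _ = 9 / 2 * ε₀ ^ 2 / (1 + s ^ 2) ^ 2 := by rw [div_pow, mul_div_assoc]
      _ ≤ _ := by gcongr
  set Ψ : ℝ × ℝ → ℂ := fun p => ψ p.1 p.2 with hΨ
  set H : ℝ × ℝ → ℝ := fun p => √((1 - p.2 * k p.1) ^ 2 + p.2 ^ 2 * σ p.1 ^ 2) with hH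
  set Ψs : ℝ × ℝ → ℂ := fun p => fderiv ℝ Ψ p (1, 0) with hΨs
  set Ψt : ℝ × ℝ → ℂ := fun p => fderiv ℝ Ψ p (0, 1) with hΨt
  have hΨcont : Continuous Ψ := hψ.continuous
  have hfd : Continuous (fderiv ℝ Ψ) := hψ.continuous_fderiv (by simp)
  have hΨsc : Continuous Ψs := hfd.clm_apply continuous_const
  have hΨtc : Continuous Ψt := hfd.clm_apply continuous_const
  have hdiff : ∀ p, HasFDerivAt Ψ (fderiv ℝ Ψ p) p := fun p =>
    ((hψ.differentiable (by simp)) p).hasFDerivAt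
  have hds : ∀ s t, HasDerivAt (fun x => ψ x t) (Ψs (s, t)) s := fun s t =>
    (hdiff (s, t)).comp_hasDerivAt (f := fun x => (x, t)) s ((hasDerivAt_id s).prodMk (hasDerivAt_const s t))
  have hdt : ∀ s t, HasDerivAt (ψ s) (Ψt (s, t)) t := fun s t =>
    (hdiff (s, t)).comp_hasDerivAt (f := fun x => (s, x)) t ((hasDerivAt_const t s).prodMk (hasDerivAt_id t))
  have hΨ0 : ∀ p ∉ tsupport Ψ, Ψ p = 0 := fun p hp => image_eq_zero_of_notMem_tsupport hp
  have hΨs0 : ∀ p ∉ tsupport Ψ, Ψs p = 0 := fun p hp => by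
    simp [hΨs, fderiv_of_notMem_tsupport ℝ hp]
  have hΨt0 : ∀ p ∉ tsupport Ψ, Ψt p = 0 := fun p hp => by
    simp [hΨt, fderiv_of_notMem_tsupport ℝ hp]
  obtain ⟨b, hb0, hba, hb⟩ : ∃ b, 0 ≤ b ∧ b < a ∧ ∀ p ∈ tsupport Ψ, |p.2| < b := by
    rcases (tsupport Ψ).eq_empty_or_nonempty with h | h
    · exact ⟨0, le_rfl, ha, by simp [h]⟩
    · obtain ⟨p, hp, hmax⟩ := hψc.isCompact.exists_isMaxOn h
        (f := fun p : ℝ × ℝ => |p.2|) (by fun_prop)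
      have hpa : |p.2| < a := abs_lt.2 (hψs hp).2
      refine ⟨(|p.2| + a) / 2, by positivity, by linarith, fun q hq => ?_⟩
      have : |q.2| ≤ |p.2| := hmax hq
      linarith
  obtain ⟨R, hR0, hR⟩ : ∃ R, 0 ≤ R ∧ ∀ p ∈ tsupport Ψ, |p.1| < R := by
    obtain ⟨R, hR⟩ := hψc.isCompact.exists_bound_of_continuousOn
      (f := fun p : ℝ × ℝ => p.1) (by fun_prop)
    exact ⟨|R| + 1, by positivity, fun p hp => by
      have : |p.1| ≤ R := hR p hp
      linarith [le_abs_self R]⟩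
  have hconv : ∀ F : ℝ × ℝ → ℝ, (∀ p ∉ tsupport Ψ, F p = 0) →
      ∫ s, ∫ t in Ioo (-a) a, F (s, t) = ∫ s, ∫ t, F (s, t) := fun F hF => by
    refine integral_congr_ae (ae_of_all _ fun s => ?_)
    exact setIntegral_eq_integral_of_forall_compl_eq_zero
      fun t ht => hF _ fun h => ht (hψs h).2
  have hintg : ∀ F : ℝ × ℝ → ℝ, Continuous F → (∀ p ∉ tsupport Ψ, F p = 0) →
      Integrable F (volume.prod volume) := fun F hF hF0 =>
    hF.integrable_of_hasCompactSupport (HasCompactSupport.intro hψc.isCompact hF0)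
  have hiter : ∀ F : ℝ × ℝ → ℝ, Continuous F → (∀ p ∉ tsupport Ψ, F p = 0) →
      ∫ s, ∫ t in Ioo (-a) a, F (s, t) = ∫ p, F p ∂(volume.prod volume) := fun F hF hF0 => by
    rw [hconv F hF0, integral_prod F (hintg F hF hF0)]
  have hHc : Continuous H := by fun_prop
  have hHb : ∀ s, ∀ t ∈ Ioo (-a) a, 1 / 2 ≤ H (s, t) ∧ H (s, t) ≤ 5 / 2 := fun s t ht =>
    (strip_weight_bounds (hσδ s) (hkδ s) ht).2
  set U : ℝ → ℝ := fun s => δ / 125 * σ s ^ 2 - 9 / 2 * k s ^ 2 with hU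
  have hUc : Continuous U := by fun_prop
  set E : ℝ := π ^ 2 / (2 * a) ^ 2 with hE
  -- the inverse weight is made globally continuous without changing it on the strip
  set F₁ : ℝ × ℝ → ℝ := fun p => (max (H p) (1 / 2))⁻¹ * ‖Ψs p‖ ^ 2 with hF₁
  set F₂ : ℝ × ℝ → ℝ := fun p => H p * ‖Ψt p‖ ^ 2 with hF₂
  set F₃ : ℝ × ℝ → ℝ := fun p => ‖Ψ p‖ ^ 2 * H p with hF₃
  set F₄ : ℝ × ℝ → ℝ := fun p => 2 / 5 * ‖Ψs p‖ ^ 2 with hF₄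
  set F₅ : ℝ × ℝ → ℝ := fun p => U p.1 * ‖Ψ p‖ ^ 2 with hF₅
  have c₁ : Continuous F₁ := by
    refine ((hHc.max continuous_const).inv₀ fun p => ?_).mul (hΨsc.norm.pow 2)
    exact (lt_of_lt_of_le (by norm_num) (le_max_right (H p) (1 / 2))).ne'
  have c₂ : Continuous F₂ := by fun_prop
  have c₃ : Continuous F₃ := by fun_prop
  have c₄ : Continuous F₄ := by fun_prop
  have c₅ : Continuous F₅ := by fun_prop
  have z₁ : ∀ p ∉ tsupport Ψ, F₁ p = 0 := fun p hp => by simp [hF₁, hΨs0 p hp]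
  have z₂ : ∀ p ∉ tsupport Ψ, F₂ p = 0 := fun p hp => by simp [hF₂, hΨt0 p hp]
  have z₃ : ∀ p ∉ tsupport Ψ, F₃ p = 0 := fun p hp => by simp [hF₃, hΨ0 p hp]
  have z₄ : ∀ p ∉ tsupport Ψ, F₄ p = 0 := fun p hp => by simp [hF₄, hΨs0 p hp]
  have z₅ : ∀ p ∉ tsupport Ψ, F₅ p = 0 := fun p hp => by simp [hF₅, hΨ0 p hp]
  have i₁ := hintg F₁ c₁ z₁
  have i₂ := hintg F₂ c₂ z₂
  have i₃ := hintg F₃ c₃ z₃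
  have i₄ := hintg F₄ c₄ z₄
  have i₅ := hintg F₅ c₅ z₅
  have i₂₃ : Integrable (fun p => F₂ p - E * F₃ p) (volume.prod volume) := i₂.sub (i₃.const_mul E)
  have i₂₃₅ : Integrable (fun p => F₂ p - E * F₃ p - F₅ p) (volume.prod volume) := i₂₃.sub i₅
  have i₄₅ : Integrable (fun p => F₄ p + F₅ p) (volume.prod volume) := i₄.add i₅
  have e₁ : ∫ s : ℝ, ∫ t in Ioo (-a) a, (√((1 - t * k s) ^ 2 + t ^ 2 * σ s ^ 2))⁻¹ *
      ‖deriv (fun x => ψ x t) s‖ ^ 2 = ∫ p, F₁ p ∂(volume.prod volume) := by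
    rw [← hiter F₁ c₁ z₁]
    refine integral_congr_ae (ae_of_all _ fun s => setIntegral_congr_fun measurableSet_Ioo
      fun t ht => ?_)
    simp only [hF₁, (hds s t).deriv, max_eq_left (hHb s t ht).1]
    rfl
  have e₂ : ∫ s : ℝ, ∫ t in Ioo (-a) a, √((1 - t * k s) ^ 2 + t ^ 2 * σ s ^ 2) *
      ‖deriv (ψ s) t‖ ^ 2 = ∫ p, F₂ p ∂(volume.prod volume) := by
    rw [← hiter F₂ c₂ z₂]
    simp only [hF₂, (hdt _ _).deriv]
    rfl
  have e₃ : ∫ s : ℝ, ∫ t in Ioo (-a) a, ‖ψ s t‖ ^ 2 *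
      √((1 - t * k s) ^ 2 + t ^ 2 * σ s ^ 2) = ∫ p, F₃ p ∂(volume.prod volume) := by
    rw [← hiter F₃ c₃ z₃]
  rw [e₁, e₂, e₃]
  have h₁₄ : ∫ p, F₄ p ∂(volume.prod volume) ≤ ∫ p, F₁ p ∂(volume.prod volume) := by
    refine integral_mono i₄ i₁ fun p => ?_
    by_cases hp : p ∈ tsupport Ψ
    · have hHp := hHb p.1 p.2 (hψs hp).2
      simp only [hF₁, hF₄, max_eq_left hHp.1]
      gcongr
      rw [show (2 / 5 : ℝ) = (5 / 2)⁻¹ by norm_num]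
      exact inv_anti₀ (by linarith [hHp.1]) hHp.2
    · simp only [z₁ p hp, z₄ p hp, le_refl]
  have htrans : 0 ≤ ∫ p, (F₂ p - E * F₃ p - F₅ p) ∂(volume.prod volume) := by
    rw [integral_prod _ i₂₃₅]
    refine integral_nonneg fun s => ?_
    obtain ⟨Q, Q', hQ⟩ := exists_transverse_riccati ha (hσδ s) (hkδ s)
    have hsub : ∀ t ∈ Icc (-b) b, t ∈ Ioo (-a) a := fun t ht =>
      ⟨by linarith [ht.1], by linarith [ht.2]⟩
    have key := intervalIntegral_nonneg_of_riccati (f := ψ s) (f' := fun t => Ψt (s, t))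
      (A := fun t => H (s, t)) (q := fun t => -(E * H (s, t)) - U s) hb0 (hdt s)
      (hΨ0 (s, b) fun h => (le_abs_self b).not_gt (hb _ h))
      (hΨ0 (s, -b) fun h => (neg_le_abs (-b)).not_gt (by simpa using hb _ h))
      (fun t ht => (hQ t (hsub t ht)).1)
      (fun t ht => by linarith [(hHb s t (hsub t ht)).1])
      (fun t ht => (hQ t (hsub t ht)).2)
      (Continuous.integrableOn_Icc (by
        have : Continuous (ψ s) := hΨcont.comp (Continuous.prodMk_right s)
        fun_prop))
    rw [intervalIntegral.integral_eq_integral_of_support_subset] at key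
    · refine key.trans_eq (integral_congr_ae (ae_of_all _ fun t => ?_))
      simp only [hF₂, hF₃, hF₅, hΨ]
      ring
    · intro t ht
      by_contra hn
      have hnot : (s, t) ∉ tsupport Ψ := fun h => hn (Ioo_subset_Ioc_self (abs_lt.1 (hb _ h)))
      refine ht ?_
      simp [hΨt0 _ hnot, show ψ s t = 0 from hΨ0 _ hnot]
  have hlong : 0 ≤ ∫ p, (F₄ p + F₅ p) ∂(volume.prod volume) := by
    rw [integral_prod_symm _ i₄₅]
    refine integral_nonneg fun t => ?_
    have key := intervalIntegral_nonneg_of_riccati (f := fun s => ψ s t)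
      (f' := fun s => Ψs (s, t)) (A := fun _ => 2 / 5) (q := U) hR0 (fun s => hds s t)
      (hΨ0 (R, t) fun h => (le_abs_self R).not_gt (hR _ h))
      (hΨ0 (-R, t) fun h => (neg_le_abs (-R)).not_gt (by simpa using hR _ h))
      (fun s _ => hPd s) (fun _ _ => by norm_num)
      (fun s _ => (hPR s).trans (by
        simp only [hU]
        have := hkK s
        gcongr))
      (Continuous.integrableOn_Icc (by
        have : Continuous (fun s => ψ s t) := hΨcont.comp (Continuous.prodMk_left t)
        fun_prop))
    rwa [intervalIntegral.integral_eq_integral_of_support_subset] at key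
    intro s hs
    by_contra hn
    have hnot : (s, t) ∉ tsupport Ψ := fun h => hn (Ioo_subset_Ioc_self (abs_lt.1 (hR _ h)))
    refine hs ?_
    simp [hΨs0 _ hnot, show ψ s t = 0 from hΨ0 _ hnot]
  rw [integral_sub i₂₃ i₅, integral_sub i₂ (i₃.const_mul E),
    integral_const_mul] at htrans
  rw [integral_add i₄ i₅] at hlong
  linarith
end
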